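/- arXiv:2211.16595 — 5 statements merged into one kernel-verified Lean document; each statement's English description precedes it below -/
import Mathlib

section
/- Let p be a prime, n ≥ 4 an integer, k an integer with 2 ≤ k ≤ n−2, and set r = n−1−k. Let α be the composition of length n−1 with α_1 = 2, α_k = 3, α_{n−1} = 2, and α_i = 1 for all other indices i. Then g_α(p) = r·p^{n−3+r} + p^{n−3}(p−1)(p+r−1). -/
/-- `v` lies in the ℤ-span of the columns of the square integer matrix `A`. -/
def InColSpan {n : ℕ} (A : Matrix (Fin n) (Fin n) ℤ) (v : Fin n → ℤ) : Prop :=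
  ∃ x : Fin n → ℤ, A.mulVec x = v

/-- `A` is a subring matrix: upper triangular in Hermite normal form (positive
diagonal, `0 ≤ A i j < A i i` for `i < j`), the all-ones vector lies in the
ℤ-span of the columns, and the componentwise product of any two columns lies in
the ℤ-span of the columns. -/
def IsSubringMatrix {n : ℕ} (A : Matrix (Fin n) (Fin n) ℤ) : Prop :=
  (∀ i j : Fin n, j < i → A i j = 0) ∧
  (∀ i : Fin n, 0 < A i i) ∧
  (∀ i j : Fin n, i < j → 0 ≤ A i j ∧ A i j < A i i) ∧
  InColSpan A (fun _ => 1) ∧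
  (∀ j k : Fin n, InColSpan A (fun i => A i j * A i k))

/-- `A` is an irreducible subring matrix for the prime `p` with diagonal
`(p ^ α 0, …, p ^ α (n-1), 1)`: a subring matrix with the prescribed diagonal,
whose last column has all entries equal to `1`, and all of whose off-diagonal
entries away from the last column are divisible by `p`. -/
def IsIrreducibleSubringMatrix (p : ℕ) {n : ℕ} (α : Fin n → ℕ)
    (A : Matrix (Fin (n + 1)) (Fin (n + 1)) ℤ) : Prop :=
  IsSubringMatrix A ∧
  (∀ i : Fin n, A i.castSucc i.castSucc = (p : ℤ) ^ α i) ∧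
  A (Fin.last n) (Fin.last n) = 1 ∧
  (∀ i : Fin (n + 1), A i (Fin.last n) = 1) ∧
  (∀ i j : Fin n, i < j → (p : ℤ) ∣ A i.castSucc j.castSucc)

/-- `gComp p α` : the number of irreducible subring matrices with diagonal
`(p ^ α 0, …, p ^ α (n-1), 1)`. -/
noncomputable def gComp (p : ℕ) {n : ℕ} (α : Fin n → ℕ) : ℕ :=
  Nat.card {A : Matrix (Fin (n + 1)) (Fin (n + 1)) ℤ // IsIrreducibleSubringMatrix p α A}

/-- `gNum p n e` : the number of irreducible subring matrices of size `n` with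
determinant `p ^ e` (so `gNum p 1 0 = 1` and `gNum p 1 e = 0` for `e ≥ 1`). -/
noncomputable def gNum (p : ℕ) : ℕ → ℕ → ℕ
  | 0, _ => 0
  | m + 1, e =>
      Nat.card {A : Matrix (Fin (m + 1)) (Fin (m + 1)) ℤ //
        (∃ α : Fin m → ℕ, (∀ i, 1 ≤ α i) ∧ IsIrreducibleSubringMatrix p α A) ∧
        A.det = (p : ℤ) ^ e}

theorem inColSpan_add_smul_col_iff {n : ℕ} (A : Matrix (Fin n) (Fin n) ℤ) (v : Fin n → ℤ)
    (c : ℤ) (j : Fin n) :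
    InColSpan A (fun i => v i + c * A i j) ↔ InColSpan A v := by
  have hcol : A.mulVec (Pi.single j c) = fun i => c * A i j := by
    ext i
    simp [mul_comm]
  constructor
  · rintro ⟨u, hu⟩
    refine ⟨u - Pi.single j c, ?_⟩
    rw [Matrix.mulVec_sub, hu, hcol]
    ext i
    simp
  · rintro ⟨u, hu⟩
    refine ⟨u + Pi.single j c, ?_⟩
    rw [Matrix.mulVec_add, hu, hcol]
    rfl

theorem inColSpan_col {n : ℕ} (A : Matrix (Fin n) (Fin n) ℤ) (j : Fin n) :
    InColSpan A (fun i => A i j) := by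
  have h := (inColSpan_add_smul_col_iff A 0 1 j).2 ⟨0, A.mulVec_zero⟩
  simpa using h

/-- The matrix with diagonal `(p ^ α 0, …, p ^ α (m-1), 1)` and last column `1`, whose other
entries are `p * x j` in row `z`, `p * y j` in row `k`, and `0` elsewhere. -/
def twoRowMatrix (p : ℕ) {m : ℕ} (α : Fin m → ℕ) (z k : Fin m) (x y : Fin m → ℤ) :
    Matrix (Fin (m + 1)) (Fin (m + 1)) ℤ := fun i j =>
  Fin.lastCases (motive := fun _ => ℤ) 1 (fun j' =>
    Fin.lastCases (motive := fun _ => ℤ) 0 (fun i' =>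
      (if i' = j' then (p : ℤ) ^ α j' else 0) + (if i' = k then p * y j' else 0) +
        (if i' = z then p * x j' else 0)) i) j

section twoRowMatrix

variable {p m : ℕ} {α : Fin m → ℕ} {z k : Fin m} {x y : Fin m → ℤ}

@[simp]
theorem twoRowMatrix_last_right (i : Fin (m + 1)) :
    twoRowMatrix p α z k x y i (Fin.last m) = 1 := by
  simp [twoRowMatrix]

@[simp]
theorem twoRowMatrix_last_left (j : Fin m) :
    twoRowMatrix p α z k x y (Fin.last m) j.castSucc = 0 := by
  simp [twoRowMatrix]

@[simp]
theorem twoRowMatrix_castSucc (i j : Fin m) :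
    twoRowMatrix p α z k x y i.castSucc j.castSucc =
      (if i = j then (p : ℤ) ^ α j else 0) + (if i = k then p * y j else 0) +
        (if i = z then p * x j else 0) := by
  simp [twoRowMatrix]

theorem twoRowMatrix_mulVec_last (c : Fin (m + 1) → ℤ) :
    (twoRowMatrix p α z k x y).mulVec c (Fin.last m) = c (Fin.last m) := by
  simp [Matrix.mulVec, dotProduct, Fin.sum_univ_castSucc]

theorem twoRowMatrix_mulVec_castSucc (c : Fin (m + 1) → ℤ) (i : Fin m) :
    (twoRowMatrix p α z k x y).mulVec c i.castSucc =
      (p : ℤ) ^ α i * c i.castSucc + (if i = k then p * ∑ j, y j * c j.castSucc else 0) +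
        (if i = z then p * ∑ j, x j * c j.castSucc else 0) + c (Fin.last m) := by
  simp only [Matrix.mulVec, dotProduct, Fin.sum_univ_castSucc, twoRowMatrix_castSucc,
    twoRowMatrix_last_right, add_mul, ite_mul, zero_mul, one_mul, Finset.sum_add_distrib,
    Finset.sum_ite_eq, Finset.mem_univ, if_true, Finset.mul_sum]
  congr 2
  · congr 1
    split_ifs <;> simp [mul_assoc]
  · split_ifs <;> simp [mul_assoc]

theorem inColSpan_twoRowMatrix_iff (hp : p ≠ 0) (hzk : z ≠ k) (hyz : y z = 0) (hyk : y k = 0)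
    (hxz : x z = 0) (s t : ℤ) (v : Fin (m + 1) → ℤ) (hlast : v (Fin.last m) = 0)
    (hv : ∀ i : Fin m, v i.castSucc = (if i = k then t else 0) + (if i = z then s else 0)) :
    InColSpan (twoRowMatrix p α z k x y) v ↔
      ∃ c, t = (p : ℤ) ^ α k * c ∧ (p : ℤ) ^ α z ∣ s - p * x k * c := by
  have hp' : (p : ℤ) ≠ 0 := by exact_mod_cast hp
  have hsum : ∀ (f : Fin m → ℤ) (c : Fin (m + 1) → ℤ),
      (∀ i, i ≠ z → i ≠ k → c i.castSucc = 0) →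
        ∑ j, f j * c j.castSucc = f z * c z.castSucc + f k * c k.castSucc := by
    intro f c hc
    rw [← Finset.sum_pair (f := fun j => f j * c j.castSucc) hzk]
    symm
    apply Finset.sum_subset (Finset.subset_univ _)
    intro i _ hi
    simp only [Finset.mem_insert, Finset.mem_singleton, not_or] at hi
    rw [hc i hi.1 hi.2, mul_zero]
  constructor
  · rintro ⟨c, rfl⟩
    rw [twoRowMatrix_mulVec_last] at hlast
    simp only [twoRowMatrix_mulVec_castSucc, hlast, add_zero] at hv
    have hc : ∀ i, i ≠ z → i ≠ k → c i.castSucc = 0 := by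
      intro i hiz hik
      simpa [hiz, hik, pow_ne_zero _ hp'] using hv i
    rw [hsum y c hc, hsum x c hc] at hv
    have hk := hv k
    have hz := hv z
    simp only [hzk, hzk.symm, if_true, if_false, hyz, hyk, hxz] at hk hz
    refine ⟨c k.castSucc, by linarith, c z.castSucc, by linarith⟩
  · rintro ⟨c, rfl, c', hc'⟩
    have hzk' : z.castSucc ≠ k.castSucc := by simpa using hzk
    set u : Fin (m + 1) → ℤ :=
      fun i => if i = k.castSucc then c else if i = z.castSucc then c' else 0
    have huk : u k.castSucc = c := if_pos rfl
    have huz : u z.castSucc = c' := by simp [u, hzk']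
    have hul : u (Fin.last m) = 0 := by
      simp [u, (Fin.castSucc_ne_last _).symm]
    have hu0 : ∀ i, i ≠ z → i ≠ k → u i.castSucc = 0 := by simp +contextual [u]
    refine ⟨u, ?_⟩
    ext i
    induction i using Fin.lastCases with
    | last =>
      rw [twoRowMatrix_mulVec_last, hlast, hul]
    | cast i =>
      rw [twoRowMatrix_mulVec_castSucc, hv, hsum _ _ hu0, hsum _ _ hu0, hul, huk, huz]
      by_cases hik : i = k
      · subst hik
        simp [hzk.symm, huk, hyz, hyk]
      · by_cases hiz : i = z
        · subst hiz
          simp only [hik, huz, hxz, if_true, if_false]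
          linarith
        · simp [hik, hiz, hu0]

theorem inColSpan_twoRowMatrix_mul_iff (hp : p ≠ 0) (hzk : z ≠ k) (hyz : y z = 0) (hyk : y k = 0)
    (hxz : x z = 0) (hα : ∀ i, 1 ≤ α i) (hαz : α z = 2) (hαk : α k = 3) (j l : Fin m) :
    InColSpan (twoRowMatrix p α z k x y) (fun i => twoRowMatrix p α z k x y i j.castSucc *
        twoRowMatrix p α z k x y i l.castSucc) ↔
      ∃ c, y j * y l - (if j = l then (p : ℤ) ^ (α j - 1) * y j else 0) = p * c ∧
        (p : ℤ) ∣ x k * c := by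
  have hp' : (p : ℤ) ≠ 0 := by exact_mod_cast hp
  have hpow : (p : ℤ) ^ α j = p * p ^ (α j - 1) := by
    rw [← pow_succ', Nat.sub_add_cancel (hα j)]
  rw [← inColSpan_add_smul_col_iff _ _ (if j = l then -(p : ℤ) ^ α j else 0) j.castSucc,
    inColSpan_twoRowMatrix_iff hp hzk hyz hyk hxz
      (p ^ 2 * (x j * x l) + p ^ 3 * ((if j = z then x l else 0) + (if l = z then x j else 0))
        - if j = l then p ^ 2 * (p ^ (α j - 1) * x j) else 0)
      (p ^ 2 * (y j * y l) + p ^ 4 * ((if j = k then y l else 0) + (if l = k then y j else 0))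
        - if j = l then p ^ 2 * (p ^ (α j - 1) * y j) else 0) _ (by simp)]
  · rw [hαz, hαk]
    set Y := (if j = k then y l else 0) + (if l = k then y j else 0)
    set X := (if j = z then x l else 0) + (if l = z then x j else 0)
    simp only [← mul_ite_zero (j = l)]
    set U := (p : ℤ) ^ (α j - 1) * if j = l then x j else 0
    set V := (p : ℤ) ^ (α j - 1) * if j = l then y j else 0
    constructor
    · rintro ⟨c, h1, w, h2⟩
      refine ⟨c - p * Y, ?_, x j * x l + p * X - U - x k * Y - w, ?_⟩
      · apply mul_left_cancel₀ (pow_ne_zero 2 hp')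
        linear_combination h1
      · apply mul_left_cancel₀ hp'
        linear_combination -h2
    · rintro ⟨c, h1, w, h2⟩
      refine ⟨c + p * Y, ?_, x j * x l + p * X - U - x k * Y - w, ?_⟩
      · linear_combination p ^ 2 * h1
      · linear_combination -p * h2
  · intro i
    simp only [twoRowMatrix_castSucc]
    by_cases hjl : j = l
    · subst hjl
      simp only [if_true]
      by_cases hik : i = k
      · subst hik
        by_cases hij : i = j
        · subst hij
          simp [hzk.symm, hyk, hαk]
        · simp [hzk.symm, hij, Ne.symm hij, hpow]
          ring
      · by_cases hiz : i = z
        · subst hiz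
          by_cases hij : i = j
          · subst hij
            simp [hik, hxz, hαz]
          · simp [hik, hij, Ne.symm hij, hpow]
            ring
        · by_cases hij : i = j
          · subst hij
            simp [hik, hiz]
          · simp [hik, hiz, hij]
    · simp only [hjl, if_false]
      by_cases hik : i = k
      · subst hik
        by_cases hij : i = j
        · subst hij
          simp [hzk.symm, hyk, hjl, Ne.symm hjl, hαk]
          ring
        · by_cases hil : i = l
          · subst hil
            simp [hzk.symm, hyk, hij, Ne.symm hij, hαk]
            ring
          · simp [hzk.symm, hij, Ne.symm hij, hil, Ne.symm hil]
            ring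
      · by_cases hiz : i = z
        · subst hiz
          by_cases hij : i = j
          · subst hij
            simp [hik, hxz, hjl, Ne.symm hjl, hαz]
            ring
          · by_cases hil : i = l
            · subst hil
              simp [hik, hxz, hij, Ne.symm hij, hαz]
              ring
            · simp [hik, hij, Ne.symm hij, hil, Ne.symm hil]
              ring
        · by_cases hij : i = j
          · subst hij
            simp [hik, hiz, hjl]
          · simp [hik, hiz, hij]

end twoRowMatrix

section count

variable {p m : ℕ} {z k l : Fin m}

/-- Tuples `(o, x, w)` parametrizing the irreducible subring matrices: `x` is row `z` divided
by `p`, `w` is row `k` divided by `p ^ 2` and rounded down, and `o` marks the column of row `k`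
whose entry is `p` modulo `p ^ 2`, or `o = k` if there is none. -/
noncomputable def rowData (p : ℕ) {m : ℕ} (z k l : Fin m) :
    Finset (Fin m × (Fin m → ℤ) × (Fin m → ℤ)) :=
  {q ∈ Finset.Ico k l ×ˢ
      Fintype.piFinset (fun j => if j = z then {0} else Finset.Ico (0 : ℤ) p) ×ˢ
      Fintype.piFinset (fun j => if k < j then Finset.Ico (0 : ℤ) p else {0}) |
    q.2.1 k = 0 ∨ ((∀ j, j ≠ l → q.2.2 j = 0) ∧ (q.1 = k ∨ q.2.2 l = 0))}

theorem rowData_eq (hp : 0 < p) (hzk : z < k) (hkl : k < l) :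
    rowData p z k l =
      (Finset.Ico k l ×ˢ
        Fintype.piFinset (fun j => if j = z ∨ j = k then {0} else Finset.Ico (0 : ℤ) p) ×ˢ
        Fintype.piFinset (fun j => if k < j then Finset.Ico (0 : ℤ) p else {0})) ∪
      (({k} ×ˢ
        Fintype.piFinset (fun j => if j = z then {0} else if j = k then Finset.Ioo (0 : ℤ) p
          else Finset.Ico (0 : ℤ) p) ×ˢ
        Fintype.piFinset (fun j => if j = l then Finset.Ico (0 : ℤ) p else {0})) ∪
      (Finset.Ioo k l ×ˢ
        Fintype.piFinset (fun j => if j = z then {0} else if j = k then Finset.Ioo (0 : ℤ) p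
          else Finset.Ico (0 : ℤ) p) ×ˢ {0})) := by
  have hx1 : ∀ x : Fin m → ℤ,
      x ∈ Fintype.piFinset (fun j => if j = z ∨ j = k then {0} else Finset.Ico (0 : ℤ) p) ↔
      x ∈ Fintype.piFinset (fun j => if j = z then {0} else Finset.Ico (0 : ℤ) p) ∧ x k = 0 := by
    intro x
    simp only [Fintype.mem_piFinset]
    refine ⟨fun h => ⟨fun j => ?_, by simpa using h k⟩, fun h j => ?_⟩
    · have := h j
      by_cases hjz : j = z <;> by_cases hjk : j = k <;> simp_all
    · have := h.1 j
      by_cases hjz : j = z <;> by_cases hjk : j = k <;> simp_all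
  have hx2 : ∀ x : Fin m → ℤ,
      x ∈ Fintype.piFinset (fun j => if j = z then {0} else if j = k then Finset.Ioo (0 : ℤ) p
          else Finset.Ico (0 : ℤ) p) ↔
      x ∈ Fintype.piFinset (fun j => if j = z then {0} else Finset.Ico (0 : ℤ) p) ∧ x k ≠ 0 := by
    intro x
    simp only [Fintype.mem_piFinset]
    refine ⟨fun h => ⟨fun j => ?_, ?_⟩, fun h j => ?_⟩
    · have := h j
      by_cases hjz : j = z <;> by_cases hjk : j = k <;> simp_all
      omega
    · have := h k
      simp [hzk.ne'] at this
      omega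
    · have h1 := h.1 j
      by_cases hjz : j = z
      · simpa [hjz] using h1
      · by_cases hjk : j = k
        · subst hjk
          simp only [hjz, if_true, if_false, Finset.mem_Ico, Finset.mem_Ioo] at h1 ⊢
          have h2 := h.2
          omega
        · simpa [hjz, hjk] using h1
  have hw1 : ∀ w : Fin m → ℤ,
      w ∈ Fintype.piFinset (fun j => if j = l then Finset.Ico (0 : ℤ) p else {0}) ↔
      w ∈ Fintype.piFinset (fun j => if k < j then Finset.Ico (0 : ℤ) p else {0}) ∧
        ∀ j, j ≠ l → w j = 0 := by
    intro w
    simp only [Fintype.mem_piFinset]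
    refine ⟨fun h => ⟨fun j => ?_, fun j hj => by simpa [hj] using h j⟩, fun h j => ?_⟩
    · have h1 := h j
      by_cases hjl : j = l
      · simpa [hjl, hkl] using h1
      · rw [if_neg hjl, Finset.mem_singleton] at h1
        by_cases hjk : k < j <;> simp [h1, hjk, hp]
    · by_cases hjl : j = l
      · simpa [hjl, hkl] using h.1 j
      · simpa [hjl] using h.2 j hjl
  have hw2 : ∀ w : Fin m → ℤ, w = 0 ↔
      w ∈ Fintype.piFinset (fun j => if k < j then Finset.Ico (0 : ℤ) p else {0}) ∧
        (∀ j, j ≠ l → w j = 0) ∧ w l = 0 := by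
    intro w
    refine ⟨?_, fun h => funext fun j => ?_⟩
    · rintro rfl
      simp only [Fintype.mem_piFinset]
      refine ⟨fun j => ?_, by simp⟩
      by_cases hjk : k < j <;> simp [hjk, hp]
    · by_cases hj : j = l
      · exact hj ▸ h.2.2
      · exact h.2.1 j hj
  have key : ∀ O' O X W X' W' V : Prop,
      (((O' ∨ O) ∧ X ∧ W) ∧ (X' ∨ W' ∧ (O' ∨ V)) ↔
        (O' ∨ O) ∧ (X ∧ X') ∧ W ∨ O' ∧ (X ∧ ¬ X') ∧ W ∧ W' ∨ O ∧ (X ∧ ¬ X') ∧ W ∧ W' ∧ V) := by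
    intro O' O X W X' W' V
    by_cases X' <;> by_cases O' <;> by_cases W' <;> simp [*] <;> tauto
  ext ⟨o, x, w⟩
  have ho : o ∈ Finset.Ico k l ↔ o = k ∨ o ∈ Finset.Ioo k l := by
    rw [← Finset.Ioo_insert_left hkl, Finset.mem_insert]
  simp only [rowData, Finset.mem_filter, Finset.mem_product, Finset.mem_union,
    Finset.mem_singleton, hx1, hx2, hw1, hw2 w, ho]
  apply key

theorem card_rowData (hp : 0 < p) (hzk : z < k) (hkl : k < l)
    (hl : l.val + 1 = m) :
    (rowData p z k l).card = (l - k : ℕ) * p ^ (m - 2 + (l - k)) +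
      p ^ (m - 2) * (p - 1) * (p + (l - k) - 1) := by
  have hz : (Finset.univ.filter fun j : Fin m => j = z ∨ j = k) = {z, k} := by
    ext; simp
  have hcard1 : (Fintype.piFinset (fun j : Fin m =>
      if j = z ∨ j = k then {0} else Finset.Ico (0 : ℤ) p)).card = p ^ (m - 2) := by
    rw [Fintype.card_piFinset]
    simp only [apply_ite Finset.card, Finset.card_singleton, Int.card_Ico, sub_zero,
      Int.toNat_natCast, Finset.prod_ite, Finset.prod_const, one_pow, one_mul]
    rw [Finset.filter_not, hz, Finset.card_sdiff_of_subset (Finset.subset_univ _),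
      Finset.card_pair hzk.ne, Finset.card_univ, Fintype.card_fin]
  have hcard2 : (Fintype.piFinset (fun j : Fin m => if j = z then {0} else
      if j = k then Finset.Ioo (0 : ℤ) p else Finset.Ico (0 : ℤ) p)).card =
      p ^ (m - 2) * (p - 1) := by
    rw [← hcard1, Fintype.card_piFinset, Fintype.card_piFinset,
      ← Finset.mul_prod_erase Finset.univ _ (Finset.mem_univ k),
      ← Finset.mul_prod_erase Finset.univ _ (Finset.mem_univ k)]
    have : ∀ j ∈ Finset.univ.erase k, (if j = z ∨ j = k then {0} else Finset.Ico (0 : ℤ) p) =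
        (if j = z then {0} else
          if j = k then Finset.Ioo (0 : ℤ) p else Finset.Ico (0 : ℤ) p) := by
      intro j hj
      simp [Finset.ne_of_mem_erase hj]
    rw [Finset.prod_congr rfl fun j hj => congrArg Finset.card (this j hj)]
    simp [hzk.ne', mul_comm]
  have hcard3 : (Fintype.piFinset (fun j : Fin m =>
      if k < j then Finset.Ico (0 : ℤ) p else {0})).card = p ^ (l - k : ℕ) := by
    rw [Fintype.card_piFinset]
    simp only [apply_ite Finset.card, Finset.card_singleton, Int.card_Ico, sub_zero,
      Int.toNat_natCast, Finset.prod_ite, Finset.prod_const, one_pow, mul_one]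
    rw [Finset.filter_lt_eq_Ioi, Fin.card_Ioi]
    congr 1
    omega
  have hcard4 : (Fintype.piFinset (fun j : Fin m =>
      if j = l then Finset.Ico (0 : ℤ) p else {0})).card = p := by
    simp [Fintype.card_piFinset, apply_ite Finset.card]
  have hlt : (k : ℕ) < l := hkl
  rw [rowData_eq hp hzk hkl, Finset.card_union_of_disjoint, Finset.card_union_of_disjoint]
  · simp only [Finset.card_product, hcard1, hcard2, hcard3, hcard4, Fin.card_Ico, Fin.card_Ioo,
      Finset.card_singleton]
    obtain ⟨s, hs⟩ : ∃ s, (l - k : ℕ) = s + 1 := ⟨l - k - 1, by omega⟩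
    rw [hs, show p + (s + 1) - 1 = p + s by omega, Nat.add_sub_cancel]
    ring
  · rw [Finset.disjoint_left]
    rintro ⟨o, x, w⟩ h1 h2
    simp only [Finset.mem_product, Finset.mem_singleton, Finset.mem_Ioo] at h1 h2
    exact absurd h1.1 h2.1.1.ne'
  · rw [Finset.disjoint_left]
    rintro ⟨o, x, w⟩ h1 h2
    simp only [Finset.mem_product, Finset.mem_union, Fintype.mem_piFinset] at h1 h2
    have h0 := h1.2.1 k
    have h3 : x k ∈ (if k = z then {0} else
      if k = k then Finset.Ioo (0 : ℤ) p else Finset.Ico (0 : ℤ) p) :=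
        h2.elim (fun h => h.2.1 k) (fun h => h.2.1 k)
    simp [hzk.ne'] at h0 h3
    omega

end count

/-- The off-diagonal part of row `k`, divided by `p`, encoded by `(o, x, w)` in `rowData`. -/
def markedRow (p : ℕ) {m : ℕ} (k o : Fin m) (w : Fin m → ℤ) (j : Fin m) : ℤ :=
  (if k < j ∧ j = o then 1 else 0) + p * w j

section classification

variable {p m : ℕ} {α : Fin m → ℕ} {z k l : Fin m} {x y w : Fin m → ℤ} {o : Fin m}

theorem mem_rowData :
    (o, x, w) ∈ rowData p z k l ↔ (k ≤ o ∧ o < l) ∧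
      (x z = 0 ∧ ∀ j, z ≠ j → 0 ≤ x j ∧ x j < p) ∧
      ((∀ j, k < j → 0 ≤ w j ∧ w j < p) ∧ ∀ j, j ≤ k → w j = 0) ∧
      (x k = 0 ∨ ((∀ j, j ≠ l → w j = 0) ∧ (o = k ∨ w l = 0))) := by
  have hx : (∀ j, x j ∈ if j = z then {0} else Finset.Ico (0 : ℤ) p) ↔
      (x z = 0 ∧ ∀ j, z ≠ j → 0 ≤ x j ∧ x j < p) := by
    refine ⟨fun h => ⟨by simpa using h z, fun j hj => by simpa [hj.symm] using h j⟩,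
      fun h j => ?_⟩
    by_cases hj : j = z
    · simp [hj, h.1]
    · simpa [hj] using h.2 j (Ne.symm hj)
  have hw : (∀ j, w j ∈ if k < j then Finset.Ico (0 : ℤ) p else {0}) ↔
      ((∀ j, k < j → 0 ≤ w j ∧ w j < p) ∧ ∀ j, j ≤ k → w j = 0) := by
    refine ⟨fun h => ⟨fun j hj => by simpa [hj] using h j,
      fun j hj => by simpa [not_lt.2 hj] using h j⟩, fun h j => ?_⟩
    by_cases hj : k < j
    · simpa [hj] using h.1 j hj
    · simpa [hj] using h.2 j (not_lt.1 hj)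
  simp only [rowData, Finset.mem_filter, Finset.mem_product, Fintype.mem_piFinset, hx, hw,
    Finset.mem_Ico]
  tauto

theorem markedRow_mul_sub (hkl : k < l) (ho : k ≤ o ∧ o < l) (hw : ∀ j, j ≤ k → w j = 0)
    (hα : ∀ j, k < j → α j = if j = l then 2 else 1)
    (hxw : x k = 0 ∨ ((∀ j, j ≠ l → w j = 0) ∧ (o = k ∨ w l = 0))) (i j : Fin m) :
    ∃ c, markedRow p k o w i * markedRow p k o w j -
      (if i = j then (p : ℤ) ^ (α i - 1) * markedRow p k o w i else 0) = p * c ∧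
        (p : ℤ) ∣ x k * c := by
  have hlo : l ≠ o := ho.2.ne'
  have hlow : ∀ j, j ≤ k → markedRow p k o w j = 0 := fun j hj => by
    simp [markedRow, hw j hj, hj.not_gt]
  rcases le_or_gt i k with hi | hi
  · exact ⟨0, by simp [hlow i hi], by simp⟩
  rcases le_or_gt j k with hj | hj
  · exact ⟨0, by
      have : i ≠ j := by rintro rfl; exact hi.not_ge hj
      simp [hlow j hj, this], by simp⟩
  have hm : ∀ j, k < j → markedRow p k o w j = (if j = o then 1 else 0) + p * w j :=
    fun j hj => by simp [markedRow, hj]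
  rw [hm i hi, hm j hj, hα i hi]
  rcases hxw with hx | ⟨hw', how⟩
  · simp only [hx, zero_mul, dvd_zero, and_true]
    by_cases hij : i = j
    · subst hij
      by_cases hil : i = l
      · subst hil
        simp only [hlo, if_true, if_false]
        exact ⟨p * w i ^ 2 - p * w i, by ring⟩
      · simp only [hil, if_true, if_false]
        by_cases hio : i = o
        · simp only [hio, if_true]
          exact ⟨w o + p * w o ^ 2, by ring⟩
        · simp only [hio, if_false]
          exact ⟨p * w i ^ 2 - w i, by ring⟩
    · simp only [hij, if_false]
      by_cases hio : i = o
      · have hjo : j ≠ o := fun h => hij (hio.trans h.symm)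
        simp only [hio, hjo, if_true, if_false]
        exact ⟨w j + p * w o * w j, by ring⟩
      · simp only [hio, if_false]
        exact ⟨w i * ((if j = o then 1 else 0) + p * w j), by ring⟩
  · by_cases hil : i = l
    · subst hil
      simp only [hlo, if_true, if_false]
      by_cases hij : i = j
      · subst hij
        simp only [hlo, if_true, if_false]
        exact ⟨p * (w i ^ 2 - w i), by ring, x k * (w i ^ 2 - w i), by ring⟩
      · have hprod : w i * (if j = o then 1 else 0) = 0 := by
          by_cases hjo : j = o
          · rw [how.resolve_left (fun h => (hjo.trans h ▸ hj).false), zero_mul]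
          · simp [hjo]
        refine ⟨0, ?_, by simp⟩
        rw [hw' j (Ne.symm hij), if_neg hij]
        linear_combination p * hprod
    · rw [hw' i hil]
      by_cases hij : i = j
      · subst hij
        rw [hw' i hil]
        refine ⟨0, ?_, by simp⟩
        by_cases hio : i = o
        · simp [hio, ho.2.ne]
        · simp [hio]
      · simp only [hij, if_false]
        by_cases hio : i = o
        · have hjo : j ≠ o := fun h => hij (hio.trans h.symm)
          have hwj : w j = 0 := by
            by_cases hjl : j = l
            · rw [hjl]
              exact how.resolve_left (fun h => (hio.trans h ▸ hi).false)
            · exact hw' j hjl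
          exact ⟨0, by simp [hjo, hwj], by simp⟩
        · exact ⟨0, by simp [hio], by simp⟩

theorem exists_markedRow (hp : p.Prime) (hkl : k < l) (hl : ∀ j, j ≤ l)
    (hα : ∀ j, k < j → α j = if j = l then 2 else 1)
    (hx : 0 ≤ x k ∧ x k < p) (hy : ∀ j, k < j → 0 ≤ y j ∧ y j < p ^ 2) (hy0 : ∀ j, j ≤ k → y j = 0)
    (h : ∀ i j, ∃ c, y i * y j - (if i = j then (p : ℤ) ^ (α i - 1) * y i else 0) = p * c ∧
        (p : ℤ) ∣ x k * c) :
    ∃ (o : Fin m) (w : Fin m → ℤ), (k ≤ o ∧ o < l) ∧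
      ((∀ j, k < j → 0 ≤ w j ∧ w j < p) ∧ ∀ j, j ≤ k → w j = 0) ∧
      (x k = 0 ∨ ((∀ j, j ≠ l → w j = 0) ∧ (o = k ∨ w l = 0))) ∧ y = markedRow p k o w := by
  have hpZ : Prime (p : ℤ) := Nat.prime_iff_prime_int.1 hp
  have hp0 : (0 : ℤ) < p := by exact_mod_cast hp.pos
  have hyl : (p : ℤ) ∣ y l := by
    obtain ⟨c, hc, -⟩ := h l l
    simp only [if_true, hα l hkl] at hc
    refine hpZ.dvd_of_dvd_pow (n := 2) ⟨c + y l, ?_⟩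
    linear_combination hc
  have hone : ∀ j, k < j → ¬ (p : ℤ) ∣ y j → (p : ℤ) ∣ y j - 1 := by
    intro j hj hjp
    have hjl : j ≠ l := by rintro rfl; exact hjp hyl
    obtain ⟨c, hc, -⟩ := h j j
    simp only [if_true, hα j hj, if_neg hjl] at hc
    refine (hpZ.dvd_or_dvd (a := y j) ⟨c, ?_⟩).resolve_left hjp
    linear_combination hc
  obtain ⟨o, ho, hdvd⟩ : ∃ o, (k ≤ o ∧ o < l) ∧
      ∀ j, (p : ℤ) ∣ y j - if k < j ∧ j = o then 1 else 0 := by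
    by_cases hall : ∀ j, (p : ℤ) ∣ y j
    · refine ⟨k, ⟨le_rfl, hkl⟩, fun j => ?_⟩
      rw [if_neg (fun hj => hj.1.ne' hj.2), sub_zero]
      exact hall j
    · push Not at hall
      obtain ⟨o, ho⟩ := hall
      have hko : k < o := by
        by_contra hko
        exact ho (by simp [hy0 o (not_lt.1 hko)])
      have hol : o ≠ l := by rintro rfl; exact ho hyl
      refine ⟨o, ⟨hko.le, lt_of_le_of_ne (hl o) hol⟩, fun j => ?_⟩
      by_cases hjo : j = o
      · subst hjo
        simpa [hko] using hone j hko ho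
      · rw [if_neg (fun hj => hjo hj.2), sub_zero]
        obtain ⟨c, hc, -⟩ := h j o
        rw [if_neg hjo, sub_zero] at hc
        exact (hpZ.dvd_or_dvd ⟨c, hc⟩).resolve_right ho
  choose w hw using hdvd
  have hyw : y = markedRow p k o w := by
    ext j
    rw [markedRow, ← hw]
    ring
  have hw0 : ∀ j, j ≤ k → w j = 0 := by
    intro j hj
    have := hw j
    rw [hy0 j hj, if_neg (fun h => h.1.not_ge hj)] at this
    simpa [hp.ne_zero] using this.symm
  have hwp : ∀ j, k < j → 0 ≤ w j ∧ w j < p := by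
    intro j hj
    have h1 := hy j hj
    have h2 := hw j
    have hp1 : (1 : ℤ) < p := by exact_mod_cast hp.one_lt
    constructor
    · by_contra! hneg
      have : p * w j ≤ p * (-1) := by gcongr; omega
      split_ifs at h2 <;> linarith
    · by_contra! hge
      have : (p : ℤ) * p ≤ p * w j := by gcongr
      split_ifs at h2 <;> nlinarith
  refine ⟨o, w, ho, ⟨hwp, hw0⟩, ?_, hyw⟩
  by_cases hxk : x k = 0
  · exact Or.inl hxk
  right
  have hxp : ¬ (p : ℤ) ∣ x k := fun hd =>
    absurd (Int.le_of_dvd (lt_of_le_of_ne hx.1 (Ne.symm hxk)) hd) (not_le.2 hx.2)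
  have hz : ∀ j, k < j → (p : ℤ) ∣ w j → w j = 0 := fun j hj hd =>
    Int.eq_zero_of_dvd_of_nonneg_of_lt (hwp j hj).1 (hwp j hj).2 hd
  have hyw' : ∀ j, y j = (if k < j ∧ j = o then 1 else 0) + p * w j := fun j => by
    rw [hyw, markedRow]
  refine ⟨fun j hjl => ?_, or_iff_not_imp_left.2 fun hok => ?_⟩
  · rcases le_or_gt j k with hj | hj
    · exact hw0 j hj
    obtain ⟨c, hc, hd⟩ := h j j
    obtain ⟨d, rfl⟩ := (hpZ.dvd_or_dvd hd).resolve_left hxp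
    simp only [if_true, hα j hj, if_neg hjl, hyw', hj, true_and] at hc
    apply hz j hj
    by_cases hjo : j = o
    · simp only [hjo, if_true] at hc ⊢
      refine ⟨d - w o ^ 2, mul_left_cancel₀ hp0.ne' ?_⟩
      linear_combination hc
    · simp only [hjo, if_false] at hc
      refine ⟨w j ^ 2 - d, mul_left_cancel₀ hp0.ne' ?_⟩
      linear_combination -hc
  · have hko : k < o := lt_of_le_of_ne ho.1 (Ne.symm hok)
    obtain ⟨c, hc, hd⟩ := h o l
    obtain ⟨d, rfl⟩ := (hpZ.dvd_or_dvd hd).resolve_left hxp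
    simp only [hyw', ho.2.ne, ho.2.ne', hko, and_false, and_self, if_true, if_false] at hc
    apply hz l hkl
    refine ⟨d - w o * w l, mul_left_cancel₀ hp0.ne' ?_⟩
    linear_combination hc

theorem markedRow_injective (hp : p.Prime) {o' : Fin m} {w' : Fin m → ℤ} (ho : k ≤ o)
    (ho' : k ≤ o') (h : markedRow p k o w = markedRow p k o' w') : o = o' ∧ w = w' := by
  have hpZ : Prime (p : ℤ) := Nat.prime_iff_prime_int.1 hp
  have hiff : ∀ j, (k < j ∧ j = o) ↔ (k < j ∧ j = o') := by
    intro j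
    have hj := congrFun h j
    simp only [markedRow] at hj
    by_cases h1 : k < j ∧ j = o <;> by_cases h2 : k < j ∧ j = o'
    · exact iff_of_true h1 h2
    · rw [if_pos h1, if_neg h2] at hj
      exact absurd (isUnit_of_dvd_one ⟨w' j - w j, by linear_combination hj⟩) hpZ.not_isUnit
    · rw [if_neg h1, if_pos h2] at hj
      exact absurd (isUnit_of_dvd_one ⟨w j - w' j, by linear_combination -hj⟩) hpZ.not_isUnit
    · exact iff_of_false h1 h2
  constructor
  · rcases ho.eq_or_lt with rfl | hko
    · rcases ho'.eq_or_lt with rfl | hko'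
      · rfl
      · exact ((hiff o').2 ⟨hko', rfl⟩).2.symm
    · exact ((hiff o).1 ⟨hko, rfl⟩).2
  · ext j
    have hj := congrFun h j
    simp only [markedRow, hiff j, add_right_inj] at hj
    exact mul_left_cancel₀ hpZ.ne_zero hj

end classification

section irreducible

variable {p m : ℕ} {α : Fin m → ℕ} {z k l : Fin m}

theorem isIrreducibleSubringMatrix_iff (hp : p.Prime) (hz : ∀ j, z ≤ j) (hzk : z < k)
    (hkl : k < l) (hl : ∀ j, j ≤ l) (hαz : α z = 2) (hαk : α k = 3) (hαl : α l = 2)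
    (hα : ∀ j, j ≠ z → j ≠ k → j ≠ l → α j = 1) (A : Matrix (Fin (m + 1)) (Fin (m + 1)) ℤ) :
    IsIrreducibleSubringMatrix p α A ↔ ∃ x y : Fin m → ℤ,
      (x z = 0 ∧ ∀ j, z ≠ j → 0 ≤ x j ∧ x j < p) ∧
      (∀ j, k < j → 0 ≤ y j ∧ y j < p ^ 2) ∧ (∀ j, j ≤ k → y j = 0) ∧
      (∀ i j, ∃ c, y i * y j - (if i = j then (p : ℤ) ^ (α i - 1) * y i else 0) = p * c ∧
        (p : ℤ) ∣ x k * c) ∧ A = twoRowMatrix p α z k x y := by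
  have hp0 : (0 : ℤ) < p := by exact_mod_cast hp.pos
  have hα1 : ∀ i, 1 ≤ α i := by
    intro i
    by_cases h1 : i = z
    · rw [h1, hαz]; norm_num
    by_cases h2 : i = k
    · rw [h2, hαk]; norm_num
    by_cases h3 : i = l
    · rw [h3, hαl]; norm_num
    rw [hα i h1 h2 h3]
  constructor
  · rintro ⟨⟨htri, hpos, hbd, hone, hmul⟩, hdiag, hlast, hcol, hdvd⟩
    have hbd' : ∀ i j : Fin m, i < j →
        0 ≤ A i.castSucc j.castSucc ∧ A i.castSucc j.castSucc < (p : ℤ) ^ α i := by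
      intro i j hij
      rw [← hdiag i]
      exact hbd _ _ (by simpa using hij)
    let x : Fin m → ℤ := fun j => if j = z then 0 else A z.castSucc j.castSucc / p
    let y : Fin m → ℤ := fun j => if k < j then A k.castSucc j.castSucc / p else 0
    have hxz : x z = 0 := by simp [x]
    have hy0 : ∀ j, j ≤ k → y j = 0 := fun j hj => by simp [y, hj.not_gt]
    have hx : ∀ j, z ≠ j → p * x j = A z.castSucc j.castSucc := by
      intro j hj
      simp only [x, if_neg hj.symm]
      exact Int.mul_ediv_cancel' (hdvd z j (lt_of_le_of_ne (hz j) hj))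
    have hy : ∀ j, k < j → p * y j = A k.castSucc j.castSucc := by
      intro j hj
      simp only [y, if_pos hj]
      exact Int.mul_ediv_cancel' (hdvd k j hj)
    have hA : A = twoRowMatrix p α z k x y := by
      ext i j
      induction j using Fin.lastCases with
      | last => rw [hcol, twoRowMatrix_last_right]
      | cast j =>
        induction i using Fin.lastCases with
        | last => rw [twoRowMatrix_last_left, htri _ _ (Fin.castSucc_lt_last j)]
        | cast i =>
          rw [twoRowMatrix_castSucc]
          rcases lt_trichotomy i j with hij | rfl | hij
          · by_cases hik : i = k
            · subst hik
              simp [hij.ne, hzk.ne', hy j hij]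
            by_cases hiz : i = z
            · subst hiz
              simp [hij.ne, hik, hx j hij.ne]
            have hil : i ≠ l := (hij.trans_le (hl j)).ne
            have hb := hbd' i j hij
            rw [hα i hiz hik hil, pow_one] at hb
            simp [hij.ne, hik, hiz, Int.eq_zero_of_dvd_of_nonneg_of_lt hb.1 hb.2 (hdvd i j hij)]
          · rw [hdiag]
            by_cases hik : i = k
            · subst hik
              simp [hzk.ne', hy0]
            by_cases hiz : i = z
            · subst hiz
              simp [hik, hxz]
            simp [hik, hiz]
          · rw [htri _ _ (by simpa using hij)]
            have hiz : i ≠ z := ((hz j).trans_lt hij).ne'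
            by_cases hik : i = k
            · subst hik
              simp [hij.ne', hiz, hy0 j hij.le]
            simp [hij.ne', hik, hiz]
    refine ⟨x, y, ⟨hxz, fun j hj => ?_⟩, fun j hj => ?_, hy0, fun i j => ?_, hA⟩
    · have hb := hbd' z j (lt_of_le_of_ne (hz j) hj)
      rw [← hx j hj, hαz, pow_two] at hb
      exact ⟨nonneg_of_mul_nonneg_right hb.1 hp0, lt_of_mul_lt_mul_left hb.2 hp0.le⟩
    · have hb := hbd' k j hj
      rw [← hy j hj, hαk, pow_succ'] at hb
      exact ⟨nonneg_of_mul_nonneg_right hb.1 hp0, lt_of_mul_lt_mul_left hb.2 hp0.le⟩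
    · rw [← inColSpan_twoRowMatrix_mul_iff hp.ne_zero hzk.ne (hy0 z hzk.le) (hy0 k le_rfl) hxz
        hα1 hαz hαk, ← hA]
      exact hmul _ _
  · rintro ⟨x, y, ⟨hxz, hx⟩, hy, hy0, hQ, rfl⟩
    have hdiag : ∀ i : Fin m, twoRowMatrix p α z k x y i.castSucc i.castSucc = (p : ℤ) ^ α i := by
      intro i
      by_cases hik : i = k
      · subst hik
        simp [hzk.ne', hy0]
      by_cases hiz : i = z
      · subst hiz
        simp [hik, hxz]
      simp [hik, hiz]
    have hupper : ∀ i j : Fin m, i < j → ∃ c : ℤ,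
        twoRowMatrix p α z k x y i.castSucc j.castSucc = p * c ∧
          0 ≤ c ∧ c < (p : ℤ) ^ (α i - 1) := by
      intro i j hij
      by_cases hik : i = k
      · subst hik
        exact ⟨y j, by simp [hij.ne, hzk.ne'], by simpa [hαk] using hy j hij⟩
      by_cases hiz : i = z
      · subst hiz
        exact ⟨x j, by simp [hij.ne, hik], by simpa [hαz] using hx j hij.ne⟩
      exact ⟨0, by simp [hij.ne, hik, hiz], le_rfl, by positivity⟩
    refine ⟨⟨?_, ?_, ?_, ?_, ?_⟩, hdiag, by simp, by simp, ?_⟩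
    · intro i j hij
      induction j using Fin.lastCases with
      | last => exact absurd hij (Fin.le_last i).not_gt
      | cast j =>
        induction i using Fin.lastCases with
        | last => simp
        | cast i =>
          have hij' : j < i := by simpa using hij
          have hiz : i ≠ z := ((hz j).trans_lt hij').ne'
          by_cases hik : i = k
          · subst hik
            simp [hij'.ne', hiz, hy0 j hij'.le]
          simp [hij'.ne', hik, hiz]
    · intro i
      induction i using Fin.lastCases with
      | last => simp
      | cast i => rw [hdiag]; positivity
    · intro i j hij
      induction i using Fin.lastCases with
      | last => exact absurd hij (Fin.le_last j).not_gt
      | cast i =>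
        rw [hdiag]
        induction j using Fin.lastCases with
        | last =>
          rw [twoRowMatrix_last_right]
          have hp1 : (1 : ℤ) < p := by exact_mod_cast hp.one_lt
          exact ⟨zero_le_one, one_lt_pow₀ hp1 (Nat.one_le_iff_ne_zero.1 (hα1 i))⟩
        | cast j =>
          obtain ⟨c, hc, h0, h1⟩ := hupper i j (by simpa using hij)
          rw [hc, ← Nat.sub_add_cancel (hα1 i), pow_succ']
          exact ⟨by positivity, by gcongr⟩
    · simpa using inColSpan_col (twoRowMatrix p α z k x y) (Fin.last m)
    · intro i j
      induction j using Fin.lastCases with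
      | last => simpa using inColSpan_col (twoRowMatrix p α z k x y) i
      | cast j =>
        induction i using Fin.lastCases with
        | last => simpa using inColSpan_col (twoRowMatrix p α z k x y) j.castSucc
        | cast i =>
          rw [inColSpan_twoRowMatrix_mul_iff hp.ne_zero hzk.ne (hy0 z hzk.le) (hy0 k le_rfl) hxz
            hα1 hαz hαk]
          exact hQ i j
    · intro i j hij
      obtain ⟨c, hc, -⟩ := hupper i j hij
      exact ⟨c, hc⟩

theorem twoRowMatrix_injective (hp : p ≠ 0) (hzk : z ≠ k) {x y x' y' : Fin m → ℤ}
    (h : twoRowMatrix p α z k x y = twoRowMatrix p α z k x' y') : x = x' ∧ y = y' := by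
  refine ⟨funext fun j => ?_, funext fun j => ?_⟩
  · have := congrFun₂ h z.castSucc j.castSucc
    simpa [hzk, hp] using this
  · have := congrFun₂ h k.castSucc j.castSucc
    simpa [hzk.symm, hp] using this

theorem gComp_eq_card_rowData (hp : p.Prime) (hz : ∀ j, z ≤ j) (hzk : z < k)
    (hkl : k < l) (hl : ∀ j, j ≤ l) (hαz : α z = 2) (hαk : α k = 3) (hαl : α l = 2)
    (hα : ∀ j, j ≠ z → j ≠ k → j ≠ l → α j = 1) :
    gComp p α = (rowData p z k l).card := by
  classical
  have hα' : ∀ j, k < j → α j = if j = l then 2 else 1 := by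
    intro j hj
    split_ifs with hjl
    · rw [hjl, hαl]
    · exact hα j (hzk.trans hj).ne' hj.ne' hjl
  rw [gComp, ← Finset.card_image_of_injOn
    (f := fun q => twoRowMatrix p α z k q.2.1 (markedRow p k q.1 q.2.2)) (s := rowData p z k l)]
  · apply Nat.subtype_card
    intro A
    rw [isIrreducibleSubringMatrix_iff hp hz hzk hkl hl hαz hαk hαl hα, Finset.mem_image]
    constructor
    · rintro ⟨⟨o, x, w⟩, hq, rfl⟩
      rw [mem_rowData] at hq
      obtain ⟨ho, hx, ⟨hw, hw0⟩, hxw⟩ := hq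
      refine ⟨x, markedRow p k o w, hx, fun j hj => ?_, fun j hj => ?_,
        markedRow_mul_sub hkl ho hw0 hα' hxw, rfl⟩
      · obtain ⟨h0, h1⟩ := hw j hj
        have hp1 : (1 : ℤ) < p := by exact_mod_cast hp.one_lt
        simp only [markedRow]
        constructor
        · split_ifs <;> positivity
        · have : p * w j ≤ p * (p - 1) := by gcongr; omega
          split_ifs <;> nlinarith
      · simp [markedRow, hw0 j hj, hj.not_gt]
    · rintro ⟨x, y, hx, hy, hy0, hQ, rfl⟩
      obtain ⟨o, w, ho, hw, hxw, rfl⟩ :=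
        exists_markedRow hp hkl hl hα' (hx.2 k hzk.ne) hy hy0 hQ
      exact ⟨(o, x, w), mem_rowData.2 ⟨ho, hx, hw, hxw⟩, rfl⟩
  · rintro ⟨o, x, w⟩ hq ⟨o', x', w'⟩ hq' h
    rw [Finset.mem_coe, mem_rowData] at hq hq'
    obtain ⟨rfl, hy⟩ := twoRowMatrix_injective hp.ne_zero hzk.ne h
    obtain ⟨rfl, rfl⟩ := markedRow_injective hp hq.1.1 hq'.1.1 hy
    rfl

end irreducible

theorem g_two_ones_three_ones_two (p : ℕ) (hp : p.Prime) (n : ℕ) (hn : 4 ≤ n)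
    (k : ℕ) (hk1 : 2 ≤ k) (hk2 : k ≤ n - 2) :
    gComp p (fun i : Fin (n - 1) =>
        if i.val = 0 then 2 else if i.val = k - 1 then 3 else
          if i.val = n - 2 then 2 else 1) =
      (n - 1 - k) * p ^ (n - 3 + (n - 1 - k)) +
        p ^ (n - 3) * (p - 1) * (p + (n - 1 - k) - 1) := by
  have hzk : (⟨0, by omega⟩ : Fin (n - 1)) < ⟨k - 1, by omega⟩ := Fin.mk_lt_mk.2 (by omega)
  have hkl : (⟨k - 1, by omega⟩ : Fin (n - 1)) < ⟨n - 2, by omega⟩ := Fin.mk_lt_mk.2 (by omega)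
  have hk0 : k - 1 ≠ 0 := by omega
  have hn0 : n - 2 ≠ 0 := by omega
  have hnk : n - 2 ≠ k - 1 := by omega
  rw [gComp_eq_card_rowData hp (fun j => Fin.mk_le_of_le_val (Nat.zero_le _)) hzk hkl
    (fun j => Fin.le_def.2 (by simp only; omega)) (by simp) (by simp [hk0]) (by simp [hn0, hnk])
    (fun j h1 h2 h3 => by simp_all [Fin.ext_iff]),
    card_rowData hp.pos hzk hkl (by simp only; omega)]
  simp only [show n - 2 - (k - 1) = n - 1 - k by omega, show n - 1 - 2 = n - 3 by omega]
end

section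
/- For every prime p, g_{(2,1,4,2)}(p) = 3p^4 − 2p^3, where (2,1,4,2) is the composition of 9 into 4 positive parts with entries 2, 1, 4, 2 in that order (so the corresponding irreducible subring matrices have size n = 5). -/
/-- The candidate irreducible subring matrices with diagonal `(p ^ 2, p, p ^ 4, p ^ 2, 1)`. -/
def matrix2142 (p a b c g : ℤ) : Matrix (Fin 5) (Fin 5) ℤ :=
  !![p ^ 2, p * a, p * b, p * c, 1;
     0, p, 0, 0, 1;
     0, 0, p ^ 4, p ^ 2 * g, 1;
     0, 0, 0, p ^ 2, 1;
     0, 0, 0, 0, 1]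

theorem mulVec_matrix2142 (p a b c g : ℤ) (x : Fin 5 → ℤ) :
    (matrix2142 p a b c g).mulVec x =
      ![p ^ 2 * x 0 + p * a * x 1 + p * b * x 2 + p * c * x 3 + x 4, p * x 1 + x 4,
        p ^ 4 * x 2 + p ^ 2 * g * x 3 + x 4, p ^ 2 * x 3 + x 4, x 4] := by
  ext i
  fin_cases i <;> simp [matrix2142, Matrix.mulVec, dotProduct, Fin.sum_univ_five]

theorem inColSpan_matrix2142_mul {p a b c g : ℤ} (h : p ∣ b * (g * (g - 1))) (j k : Fin 5) :
    InColSpan (matrix2142 p a b c g)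
      (fun i => matrix2142 p a b c g i j * matrix2142 p a b c g i k) := by
  wlog hjk : j ≤ k generalizing j k
  · simpa only [mul_comm] using this k j (le_of_not_ge hjk)
  have hk4 (j : Fin 5) : InColSpan (matrix2142 p a b c g)
      (fun i => matrix2142 p a b c g i j * matrix2142 p a b c g i 4) := by
    convert inColSpan_col (matrix2142 p a b c g) j using 2 with i
    fin_cases i <;> simp [matrix2142]
  have hj0 (k : Fin 5) : InColSpan (matrix2142 p a b c g)
      (fun i => matrix2142 p a b c g i 0 * matrix2142 p a b c g i k) := by
    refine ⟨![matrix2142 p a b c g 0 k, 0, 0, 0, 0], ?_⟩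
    rw [mulVec_matrix2142]
    ext i
    fin_cases i <;> simp [matrix2142]
  have of_coeffs (j k : Fin 5) (x : Fin 5 → ℤ)
      (hx : ![p ^ 2 * x 0 + p * a * x 1 + p * b * x 2 + p * c * x 3 + x 4, p * x 1 + x 4,
        p ^ 4 * x 2 + p ^ 2 * g * x 3 + x 4, p ^ 2 * x 3 + x 4, x 4] =
        fun i => matrix2142 p a b c g i j * matrix2142 p a b c g i k) :
      InColSpan (matrix2142 p a b c g)
        (fun i => matrix2142 p a b c g i j * matrix2142 p a b c g i k) :=
    ⟨x, (mulVec_matrix2142 p a b c g x).trans hx⟩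
  have h11 := of_coeffs 1 1 ![a ^ 2 - a, p, 0, 0, 0]
    (by ext i; fin_cases i <;> simp [matrix2142]; ring)
  have h12 := of_coeffs 1 2 ![a * b, 0, 0, 0, 0]
    (by ext i; fin_cases i <;> simp [matrix2142]; ring)
  have h13 := of_coeffs 1 3 ![a * c, 0, 0, 0, 0]
    (by ext i; fin_cases i <;> simp [matrix2142]; ring)
  have h22 := of_coeffs 2 2 ![b ^ 2 - p ^ 3 * b, 0, p ^ 4, 0, 0]
    (by ext i; fin_cases i <;> simp [matrix2142]; ring)
  have h23 := of_coeffs 2 3 ![b * c - p * b * g, 0, p ^ 2 * g, 0, 0]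
    (by ext i; fin_cases i <;> simp [matrix2142]; ring)
  obtain ⟨t, ht⟩ := h
  have h33 := of_coeffs 3 3 ![c ^ 2 - t - p * c, 0, g ^ 2 - g, p ^ 2, 0] (by
    ext i
    fin_cases i <;> simp [matrix2142]
    · linear_combination p * ht
    · ring)
  fin_cases j <;> fin_cases k <;> first | exact hj0 _ | exact hk4 _ | assumption | simp at hjk

theorem isIrreducibleSubringMatrix_matrix2142 {p : ℕ} (hp : 1 < p) {a b c g : ℤ}
    (ha : 0 ≤ a ∧ a < p) (hb : 0 ≤ b ∧ b < p) (hc : 0 ≤ c ∧ c < p) (hg : 0 ≤ g ∧ g < (p : ℤ) ^ 2)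
    (h : (p : ℤ) ∣ b * (g * (g - 1))) :
    IsIrreducibleSubringMatrix p ![2, 1, 4, 2] (matrix2142 p a b c g) := by
  have hp1 : (1 : ℤ) < p := by exact_mod_cast hp
  have hp' : (0 : ℤ) < p := by linarith
  have h4 : (1 : ℤ) < (p : ℤ) ^ 4 := one_lt_pow₀ hp1 (by norm_num)
  have entry {x : ℤ} (hx : 0 ≤ x ∧ x < p) : 0 ≤ (p : ℤ) * x ∧ (p : ℤ) * x < (p : ℤ) ^ 2 :=
    ⟨mul_nonneg hp'.le hx.1, by nlinarith⟩
  have hg' : 0 ≤ (p : ℤ) ^ 2 * g ∧ (p : ℤ) ^ 2 * g < (p : ℤ) ^ 4 :=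
    ⟨mul_nonneg (by positivity) hg.1, by nlinarith [pow_pos hp' 2]⟩
  refine ⟨⟨?_, ?_, ?_, ?_, inColSpan_matrix2142_mul h⟩, ?_, ?_, ?_, ?_⟩
  · intro i j hij
    fin_cases i <;> fin_cases j <;> first | rfl | simp at hij
  · intro i
    fin_cases i <;> simp [matrix2142] <;> positivity
  · intro i j hij
    fin_cases i <;> fin_cases j <;> first
      | exact entry ha | exact entry hb | exact entry hc | exact hg' | (simp at hij; done)
      | simp [matrix2142, hp, hp.pos, h4]
  · convert inColSpan_col (matrix2142 p a b c g) 4 using 2 with i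
    fin_cases i <;> rfl
  · intro i
    fin_cases i <;> simp [matrix2142]
  · rfl
  · intro i
    fin_cases i <;> rfl
  · intro i j hij
    fin_cases i <;> fin_cases j <;> simp [matrix2142] at hij ⊢
    exact dvd_mul_of_dvd_left (dvd_pow_self _ two_ne_zero) _

theorem exists_eq_matrix2142 {p : ℕ} (hp : 0 < p) {A : Matrix (Fin 5) (Fin 5) ℤ}
    (hA : IsIrreducibleSubringMatrix p ![2, 1, 4, 2] A) :
    ∃ a b c f : ℤ, A = !![(p : ℤ) ^ 2, p * a, p * b, p * c, 1;
        0, p, 0, 0, 1; 0, 0, (p : ℤ) ^ 4, p * f, 1; 0, 0, 0, (p : ℤ) ^ 2, 1; 0, 0, 0, 0, 1] ∧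
      (0 ≤ a ∧ a < p) ∧ (0 ≤ b ∧ b < p) ∧ (0 ≤ c ∧ c < p) ∧ (0 ≤ f ∧ f < (p : ℤ) ^ 3) := by
  obtain ⟨⟨hlow, -, hbd, -, -⟩, hdiag, -, hlast, hdvd⟩ := hA
  have hp' : (0 : ℤ) < p := by exact_mod_cast hp
  have row0 : ∀ j : Fin 4, 0 < j → ∃ a, A 0 j.castSucc = p * a ∧ 0 ≤ a ∧ a < (p : ℤ) := by
    intro j hj
    obtain ⟨a, ha⟩ := hdvd 0 j hj
    have h0 := hbd 0 j.castSucc hj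
    have hd : A 0 0 = (p : ℤ) ^ 2 := hdiag 0
    change A 0 j.castSucc = _ at ha
    rw [ha, hd] at h0
    exact ⟨a, ha, by nlinarith, by nlinarith⟩
  have row1 : ∀ j : Fin 4, 1 < j → A 1 j.castSucc = 0 := by
    intro j hj
    have hd : A 1 1 = (p : ℤ) ^ 1 := hdiag 1
    have h1 := hbd 1 j.castSucc hj
    rw [hd, pow_one] at h1
    exact Int.eq_zero_of_dvd_of_nonneg_of_lt h1.1 h1.2 (hdvd 1 j hj)
  obtain ⟨a, ha, ha'⟩ := row0 1 (by decide)
  obtain ⟨b, hb, hb'⟩ := row0 2 (by decide)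
  obtain ⟨c, hc, hc'⟩ := row0 3 (by decide)
  obtain ⟨f, hf⟩ := hdvd 2 3 (by decide)
  have hf' : 0 ≤ f ∧ f < (p : ℤ) ^ 3 := by
    have h2 := hbd 2 3 (by decide)
    have hd : A 2 2 = (p : ℤ) ^ 4 := hdiag 2
    change A 2 3 = _ at hf
    rw [hf, hd] at h2
    exact ⟨by nlinarith, by nlinarith⟩
  refine ⟨a, b, c, f, ?_, ha', hb', hc', hf'⟩
  ext i j
  fin_cases i <;> fin_cases j <;> first
    | exact hlow _ _ (by decide)
    | exact hlast _
    | exact ha | exact hb | exact hc | exact hf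
    | exact row1 2 (by decide) | exact row1 3 (by decide)
    | exact hdiag 0 | exact (hdiag 1).trans (pow_one _) | exact hdiag 2 | exact hdiag 3

theorem exists_eq_matrix2142_of_isIrreducibleSubringMatrix {p : ℕ} (hp : p.Prime)
    {A : Matrix (Fin 5) (Fin 5) ℤ} (hA : IsIrreducibleSubringMatrix p ![2, 1, 4, 2] A) :
    ∃ a b c g : ℤ, A = matrix2142 p a b c g ∧ (0 ≤ a ∧ a < p) ∧ (0 ≤ b ∧ b < p) ∧
      (0 ≤ c ∧ c < p) ∧ (0 ≤ g ∧ g < (p : ℤ) ^ 2) ∧ (p : ℤ) ∣ b * (g * (g - 1)) := by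
  obtain ⟨a, b, c, f, rfl, ha, hb, hc, hf⟩ := exists_eq_matrix2142 hp.pos hA
  have hp' : (0 : ℤ) < p := by exact_mod_cast hp.pos
  obtain ⟨x, hx⟩ := hA.1.2.2.2.2 3 3
  have h0 := congrFun hx 0
  have h1 := congrFun hx 1
  have h2 := congrFun hx 2
  have h3 := congrFun hx 3
  have h4 := congrFun hx 4
  simp [Matrix.mulVec, dotProduct, Fin.sum_univ_five] at h0 h1 h2 h3 h4
  have hx4 : x 4 = 0 := h4
  have hx1 : x 1 = 0 := by simpa [hx4, hp.ne_zero] using h1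
  have hx3 : x 3 = (p : ℤ) ^ 2 := by
    refine mul_left_cancel₀ (pow_pos hp' 2).ne' ?_
    linear_combination h3 - hx4
  obtain ⟨g, rfl⟩ : (p : ℤ) ∣ f := by
    refine (Nat.prime_iff_prime_int.mp hp).dvd_of_dvd_pow (n := 2) ⟨p * x 2 + f, ?_⟩
    refine mul_left_cancel₀ (pow_pos hp' 2).ne' ?_
    rw [hx3, hx4] at h2
    linear_combination -h2
  have hx2 : x 2 = g ^ 2 - g := by
    refine mul_left_cancel₀ (pow_pos hp' 4).ne' ?_
    rw [hx3, hx4] at h2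
    linear_combination h2
  refine ⟨a, b, c, g, ?_, ha, hb, hc, ⟨by nlinarith, by nlinarith⟩, c ^ 2 - x 0 - p * c, ?_⟩
  · simp only [matrix2142, sq, mul_assoc]
  · refine mul_left_cancel₀ hp'.ne' ?_
    rw [hx1, hx2, hx3, hx4] at h0
    linear_combination h0

/-- The parameters `((a, c, h), (b, k))` of the irreducible subring matrices
`matrix2142 p a b c (p * h + k)`. -/
def params2142 (p : ℕ) : Finset ((ℕ × ℕ × ℕ) × ℕ × ℕ) :=
  (Finset.range p ×ˢ Finset.range p ×ˢ Finset.range p) ×ˢ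
    ((Finset.range p ×ˢ Finset.range p) \
      ((Finset.range p \ {0}) ×ˢ (Finset.range p \ {0, 1})))

theorem card_params2142 {p : ℕ} (hp : 2 ≤ p) :
    ((params2142 p).card : ℤ) = 3 * (p : ℤ) ^ 4 - 2 * (p : ℤ) ^ 3 := by
  have h0 : ({0} : Finset ℕ) ⊆ Finset.range p := by
    simp [Finset.singleton_subset_iff]; omega
  have h01 : ({0, 1} : Finset ℕ) ⊆ Finset.range p := by
    simp [Finset.insert_subset_iff]; omega
  have hsub : (Finset.range p \ {0}) ×ˢ (Finset.range p \ {0, 1}) ⊆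
      Finset.range p ×ˢ Finset.range p :=
    Finset.product_subset_product Finset.sdiff_subset Finset.sdiff_subset
  rw [params2142, Finset.card_product, Nat.cast_mul, Finset.cast_card_sdiff hsub]
  simp only [Finset.card_product, Nat.cast_mul, Finset.cast_card_sdiff h0,
    Finset.cast_card_sdiff h01]
  simp
  ring

theorem mem_params2142 {p a b c h k : ℕ} :
    ((a, c, h), b, k) ∈ params2142 p ↔
      (a < p ∧ c < p ∧ h < p) ∧ (b < p ∧ k < p) ∧ (b = 0 ∨ k = 0 ∨ k = 1) := by
  simp only [params2142, Finset.mem_product, Finset.mem_sdiff, Finset.mem_range,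
    Finset.mem_singleton, Finset.mem_insert]
  tauto

theorem injOn_matrix2142 (p : ℕ) (hp : 0 < p) :
    Set.InjOn (fun x : (ℕ × ℕ × ℕ) × ℕ × ℕ =>
      matrix2142 p x.1.1 x.2.1 x.1.2.1 (p * x.1.2.2 + x.2.2)) (params2142 p) := by
  rintro ⟨⟨a, c, h⟩, b, k⟩ hx ⟨⟨a', c', h'⟩, b', k'⟩ hx' heq
  obtain ⟨-, ⟨-, hk⟩, -⟩ := mem_params2142.mp hx
  obtain ⟨-, ⟨-, hk'⟩, -⟩ := mem_params2142.mp hx'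
  have ha := congrFun (congrFun heq 0) 1
  have hb := congrFun (congrFun heq 0) 2
  have hc := congrFun (congrFun heq 0) 3
  have hg := congrFun (congrFun heq 2) 3
  simp [matrix2142, hp.ne'] at ha hb hc hg
  have hg' : p * h + k = p * h' + k' := by exact_mod_cast hg
  have hkk : k = k' := by
    simpa [Nat.mul_add_mod, Nat.mod_eq_of_lt hk, Nat.mod_eq_of_lt hk'] using congrArg (· % p) hg'
  subst hkk
  have hh : h = h' := Nat.eq_of_mul_eq_mul_left hp (Nat.add_right_cancel hg')
  simp [ha, hb, hc, hh]

theorem setOf_isIrreducibleSubringMatrix_2142 {p : ℕ} (hp : p.Prime) :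
    {A : Matrix (Fin 5) (Fin 5) ℤ | IsIrreducibleSubringMatrix p ![2, 1, 4, 2] A} =
      (fun x : (ℕ × ℕ × ℕ) × ℕ × ℕ =>
        matrix2142 p x.1.1 x.2.1 x.1.2.1 (p * x.1.2.2 + x.2.2)) '' params2142 p := by
  ext A
  constructor
  · intro hA
    obtain ⟨a, b, c, g, rfl, ⟨ha0, ha⟩, ⟨hb0, hb⟩, ⟨hc0, hc⟩, ⟨hg0, hg⟩, hdvd⟩ :=
      exists_eq_matrix2142_of_isIrreducibleSubringMatrix hp hA
    lift a to ℕ using ha0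
    lift b to ℕ using hb0
    lift c to ℕ using hc0
    lift g to ℕ using hg0
    norm_cast at ha hb hc hg
    refine ⟨((a, c, g / p), b, g % p), mem_params2142.mpr ⟨⟨ha, hc, ?_⟩, ⟨hb, ?_⟩, ?_⟩, ?_⟩
    · exact Nat.div_lt_of_lt_mul (by rwa [← sq])
    · exact Nat.mod_lt _ hp.pos
    · have hpp := Nat.prime_iff_prime_int.mp hp
      rcases hpp.dvd_or_dvd hdvd with h | h
      · exact Or.inl (Nat.eq_zero_of_dvd_of_lt (by exact_mod_cast h) hb)
      rcases hpp.dvd_or_dvd h with h | h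
      · exact Or.inr (Or.inl (Nat.mod_eq_zero_of_dvd (by exact_mod_cast h)))
      · right; right
        have h1 : 1 ≡ g [MOD p] := Int.natCast_modEq_iff.mp (by
          simpa using Int.modEq_iff_dvd.mpr h)
        rw [← h1, Nat.mod_eq_of_lt hp.one_lt]
    · simp only
      congr
      exact_mod_cast Nat.div_add_mod g p
  · rintro ⟨⟨⟨a, c, h⟩, b, k⟩, hx, rfl⟩
    obtain ⟨⟨ha, hc, hh⟩, ⟨hb, hk⟩, hbk⟩ := mem_params2142.mp hx
    refine isIrreducibleSubringMatrix_matrix2142 hp.one_lt ⟨by positivity, by exact_mod_cast ha⟩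
      ⟨by positivity, by exact_mod_cast hb⟩ ⟨by positivity, by exact_mod_cast hc⟩
      ⟨by positivity, ?_⟩ ?_
    · have : p * h + k < p ^ 2 := by nlinarith
      exact_mod_cast this
    · rcases hbk with rfl | rfl | rfl
      · simp
      · exact ⟨b * (h * (p * h - 1)), by push_cast; ring⟩
      · exact ⟨b * ((p * h + 1) * h), by push_cast; ring⟩

theorem g_2142 (p : ℕ) (hp : p.Prime) :
    (gComp p ![2, 1, 4, 2] : ℤ) = 3 * (p : ℤ) ^ 4 - 2 * (p : ℤ) ^ 3 := by
  rw [← card_params2142 hp.two_le, gComp]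
  have h := congrArg Set.ncard (setOf_isIrreducibleSubringMatrix_2142 hp)
  rw [(injOn_matrix2142 p hp.pos).ncard_image, Set.ncard_coe_finset] at h
  exact congrArg Nat.cast h
end

section
/- For every prime p, g_{(2,4,1,2)}(p) = p^5 + 3p^4 − p^3 − p^2, where (2,4,1,2) is the composition of 9 into 4 positive parts with entries 2, 4, 1, 2 in that order (so the corresponding irreducible subring matrices have size n = 5). -/
/-- The upper triangular matrix with diagonal `(p², p⁴, p, p², 1)`, last column of ones, vanishing
entry at `(2, 3)`, and the remaining off-diagonal entries `p` times the given parameters. -/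
def hermiteMatrix (p a b c d e : ℤ) : Matrix (Fin 5) (Fin 5) ℤ :=
  !![p ^ 2, p * a, p * b, p * d, 1;
     0, p ^ 4, p * c, p * e, 1;
     0, 0, p, 0, 1;
     0, 0, 0, p ^ 2, 1;
     0, 0, 0, 0, 1]

lemma InColSpan.add_mulVec_iff {n : ℕ} {A : Matrix (Fin n) (Fin n) ℤ} {v w : Fin n → ℤ}
    (x : Fin n → ℤ) (h : w = v + A.mulVec x) : InColSpan A w ↔ InColSpan A v := by
  constructor
  · rintro ⟨y, hy⟩
    exact ⟨y - x, by rw [Matrix.mulVec_sub, hy, h, add_sub_cancel_right]⟩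
  · rintro ⟨y, hy⟩
    exact ⟨y + x, by rw [Matrix.mulVec_add, hy, h]⟩

lemma inColSpan_hermiteMatrix_iff {p : ℤ} (hp : p ≠ 0) (a b c d e u X : ℤ) :
    InColSpan (hermiteMatrix p a b c d e) ![p ^ 2 * u, p ^ 2 * X, 0, 0, 0] ↔
      p ^ 2 ∣ X ∧ p ^ 3 ∣ a * X := by
  constructor
  · rintro ⟨x, hx⟩
    have h0 := congrFun hx 0
    have h1 := congrFun hx 1
    have h2 := congrFun hx 2
    have h3 := congrFun hx 3
    have h4 := congrFun hx 4
    simp [hermiteMatrix, Matrix.mulVec, dotProduct, Fin.sum_univ_five] at h0 h1 h2 h3 h4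
    simp [h4, hp] at h3
    simp [h4, hp] at h2
    simp only [h2, h3, h4, mul_zero, add_zero] at h0 h1
    have hX : X = p ^ 2 * x 1 := mul_left_cancel₀ (pow_ne_zero 2 hp) (by linear_combination -h1)
    refine ⟨⟨x 1, hX⟩, u - x 0, ?_⟩
    have h : a * x 1 = p * (u - x 0) := mul_left_cancel₀ hp (by linear_combination h0)
    rw [hX]
    linear_combination p ^ 2 * h
  · rintro ⟨⟨k, rfl⟩, m, hm⟩
    have h : a * k = p * m := mul_left_cancel₀ (pow_ne_zero 2 hp) (by linear_combination hm)
    refine ⟨![u - m, k, 0, 0, 0], ?_⟩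
    ext i
    fin_cases i <;>
      simp [hermiteMatrix, Matrix.mulVec, dotProduct, Fin.sum_univ_five]
    · linear_combination p * h
    · ring

/-- The parameters `(a, c, e)` for which `hermiteMatrix p a b c d e` is a subring matrix. -/
def subringParameters (p : ℤ) : Set (ℤ × ℤ × ℤ) :=
  {t | t.1 ∈ Set.Ico 0 p ∧ t.2.1 ∈ Set.Ico 0 (p ^ 3) ∧ t.2.2 ∈ Set.Ico 0 (p ^ 3) ∧
    ∀ X ∈ ({t.2.1 * (t.2.1 - 1), t.2.1 * t.2.2, t.2.2 * (t.2.2 - p)} : Set ℤ),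
      p ^ 2 ∣ X ∧ p ^ 3 ∣ t.1 * X}

lemma hermiteMatrix_mul_columns {p : ℤ} (hp : p ≠ 0) (a b c d e : ℤ) :
    (∀ j k : Fin 5, InColSpan (hermiteMatrix p a b c d e)
      (fun i => hermiteMatrix p a b c d e i j * hermiteMatrix p a b c d e i k)) ↔
    ∀ X ∈ ({c * (c - 1), c * e, e * (e - p)} : Set ℤ), p ^ 2 ∣ X ∧ p ^ 3 ∣ a * X := by
  set A := hermiteMatrix p a b c d e with hA
  have h22 : InColSpan A (fun i => A i 2 * A i 2) ↔
      p ^ 2 ∣ c * (c - 1) ∧ p ^ 3 ∣ a * (c * (c - 1)) := by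
    rw [← inColSpan_hermiteMatrix_iff hp a b c d e (b * (b - 1))]
    refine InColSpan.add_mulVec_iff ![0, 0, p, 0, 0] ?_
    ext i
    fin_cases i <;> simp [hA, hermiteMatrix] <;> ring
  have h23 : InColSpan A (fun i => A i 2 * A i 3) ↔ p ^ 2 ∣ c * e ∧ p ^ 3 ∣ a * (c * e) := by
    rw [← inColSpan_hermiteMatrix_iff hp a b c d e (b * d)]
    refine InColSpan.add_mulVec_iff 0 ?_
    ext i
    fin_cases i <;> simp [hA, hermiteMatrix] <;> ring
  have h33 : InColSpan A (fun i => A i 3 * A i 3) ↔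
      p ^ 2 ∣ e * (e - p) ∧ p ^ 3 ∣ a * (e * (e - p)) := by
    rw [← inColSpan_hermiteMatrix_iff hp a b c d e (d * (d - p))]
    refine InColSpan.add_mulVec_iff ![0, 0, 0, p ^ 2, 0] ?_
    ext i
    fin_cases i <;> simp [hA, hermiteMatrix] <;> ring
  simp only [Set.mem_insert_iff, Set.mem_singleton_iff, forall_eq_or_imp, forall_eq]
  rw [← h22, ← h23, ← h33]
  refine ⟨fun h => ⟨h 2 2, h 2 3, h 3 3⟩, fun ⟨g22, g23, g33⟩ => ?_⟩
  have h0 : ∀ k, InColSpan A (fun i => A i 0 * A i k) := fun k => by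
    refine ⟨![A 0 k, 0, 0, 0, 0], ?_⟩
    ext i
    fin_cases i <;> fin_cases k <;>
      simp [hA, hermiteMatrix, Matrix.mulVec, dotProduct, Fin.sum_univ_five]
  have h4 : ∀ k, InColSpan A (fun i => A i 4 * A i k) := fun k => by
    refine ⟨Pi.single k 1, ?_⟩
    ext i
    rw [Matrix.mulVec_single_one]
    fin_cases i <;> fin_cases k <;> simp [hA, hermiteMatrix]
  have h1 : ∀ k, InColSpan A (fun i => A i 1 * A i k) := fun k => by
    refine ⟨![a * ![p, a - p ^ 3, b - c, d - e, 0] k, A 1 k, 0, 0, 0], ?_⟩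
    ext i
    fin_cases i <;> fin_cases k <;>
      simp [hA, hermiteMatrix, Matrix.mulVec, dotProduct, Fin.sum_univ_five] <;> ring
  have comm : ∀ j k, InColSpan A (fun i => A i j * A i k) → InColSpan A (fun i => A i k * A i j) :=
    fun j k h => by simpa only [mul_comm] using h
  intro j k
  fin_cases j
  · exact h0 k
  · exact h1 k
  · fin_cases k
    exacts [comm _ _ (h0 2), comm _ _ (h1 2), g22, g23, comm _ _ (h4 2)]
  · fin_cases k
    exacts [comm _ _ (h0 3), comm _ _ (h1 3), comm _ _ g23, g33, comm _ _ (h4 3)]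
  · exact h4 k

lemma isIrreducibleSubringMatrix_iff_s13 {p : ℕ} (hp : p.Prime) (A : Matrix (Fin 5) (Fin 5) ℤ) :
    IsIrreducibleSubringMatrix p ![2, 4, 1, 2] A ↔
      ∃ b ∈ Set.Ico (0 : ℤ) p, ∃ d ∈ Set.Ico (0 : ℤ) p, ∃ t ∈ subringParameters p,
        hermiteMatrix p t.1 b t.2.1 d t.2.2 = A := by
  have hp0 : (0 : ℤ) < p := by exact_mod_cast hp.pos
  have mem_Ico_of_mul {x m : ℤ} (h : 0 ≤ p * x ∧ p * x < p * m) : x ∈ Set.Ico 0 m :=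
    ⟨nonneg_of_mul_nonneg_right h.1 hp0, lt_of_mul_lt_mul_left h.2 hp0.le⟩
  have mul_bounds {x m : ℤ} (h : x ∈ Set.Ico 0 m) : 0 ≤ p * x ∧ p * x < p * m :=
    ⟨mul_nonneg hp0.le h.1, mul_lt_mul_of_pos_left h.2 hp0⟩
  constructor
  · rintro ⟨⟨htri, -, hbd, -, hmul⟩, hdiag, -, hlast, hdvd⟩
    have d0 : A 0 0 = p ^ 2 := hdiag 0
    have d1 : A 1 1 = p ^ 4 := hdiag 1
    have d2 : A 2 2 = p ^ 1 := hdiag 2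
    have d3 : A 3 3 = p ^ 2 := hdiag 3
    obtain ⟨a, ha⟩ : (p : ℤ) ∣ A 0 1 := hdvd 0 1 (by decide)
    obtain ⟨b, hb⟩ : (p : ℤ) ∣ A 0 2 := hdvd 0 2 (by decide)
    obtain ⟨d, hd⟩ : (p : ℤ) ∣ A 0 3 := hdvd 0 3 (by decide)
    obtain ⟨c, hc⟩ : (p : ℤ) ∣ A 1 2 := hdvd 1 2 (by decide)
    obtain ⟨e, he⟩ : (p : ℤ) ∣ A 1 3 := hdvd 1 3 (by decide)
    obtain ⟨f, hf⟩ : (p : ℤ) ∣ A 2 3 := hdvd 2 3 (by decide)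
    have ba := hbd 0 1 (by decide)
    have bb := hbd 0 2 (by decide)
    have bd := hbd 0 3 (by decide)
    have bc := hbd 1 2 (by decide)
    have be := hbd 1 3 (by decide)
    have bf := hbd 2 3 (by decide)
    rw [ha, d0, sq] at ba
    rw [hb, d0, sq] at bb
    rw [hd, d0, sq] at bd
    rw [hc, d1, pow_succ'] at bc
    rw [he, d1, pow_succ'] at be
    rw [hf, d2, pow_succ', pow_zero] at bf
    have hf0 : f = 0 := by
      have := mem_Ico_of_mul bf
      simp only [Set.mem_Ico] at this
      omega
    have hA : hermiteMatrix p a b c d e = A := by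
      ext i j
      have l (i : Fin 5) : A i 4 = 1 := hlast i
      fin_cases i <;> fin_cases j <;>
        simp [hermiteMatrix, d0, d1, d2, d3, ha, hb, hc, hd, he, hf, hf0, l,
          htri 1 0, htri 2 0, htri 2 1, htri 3 0, htri 3 1, htri 3 2,
          htri 4 0, htri 4 1, htri 4 2, htri 4 3]
    rw [← hA] at hmul
    exact ⟨b, mem_Ico_of_mul bb, d, mem_Ico_of_mul bd, (a, c, e),
      ⟨mem_Ico_of_mul ba, mem_Ico_of_mul bc, mem_Ico_of_mul be,
        (hermiteMatrix_mul_columns hp0.ne' a b c d e).1 hmul⟩, hA⟩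
  · rintro ⟨b, hb, d, hd, ⟨a, c, e⟩, ⟨ha, hc, he, h⟩, rfl⟩
    refine ⟨⟨?_, ?_, ?_, ⟨![0, 0, 0, 0, 1], ?_⟩,
      (hermiteMatrix_mul_columns hp0.ne' a b c d e).2 h⟩, ?_, rfl, ?_, ?_⟩
    · intro i j
      fin_cases i <;> fin_cases j <;> simp [hermiteMatrix]
    · intro i
      fin_cases i <;> simp [hermiteMatrix, hp.pos]
    · have ba := mul_bounds ha
      have bb := mul_bounds hb
      have bc := mul_bounds hc
      have bd := mul_bounds hd
      have be := mul_bounds he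
      rw [← sq] at ba bb bd
      rw [← pow_succ'] at bc be
      intro i j
      fin_cases i <;> fin_cases j <;> simp [hermiteMatrix, hp.pos, hp.one_lt, one_lt_pow₀, *]
    · ext i
      fin_cases i <;> simp [hermiteMatrix, Matrix.mulVec, dotProduct, Fin.sum_univ_five]
    · intro i
      fin_cases i <;> simp [hermiteMatrix]
    · intro i
      fin_cases i <;> simp [hermiteMatrix]
    · intro i j
      fin_cases i <;> fin_cases j <;> simp [hermiteMatrix]

/-- An enumeration of `subringParameters p` for prime `p`. -/
def parametrize (p : ℕ) :
    (Fin p × Fin (p ^ 2) ⊕ Fin p × Fin p) ⊕ Fin (p - 1) × ((Fin p ⊕ Fin p) ⊕ Unit) → ℤ × ℤ × ℤ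
  | .inl (.inl (i, j)) => (0, p ^ 2 * i, p * j)
  | .inl (.inr (i, j)) => (0, p ^ 2 * i + 1, p ^ 2 * j)
  | .inr (k, .inl (.inl i)) => (k + 1, 0, p * (p * i))
  | .inr (k, .inl (.inr i)) => (k + 1, 0, p * (p * i + 1))
  | .inr (k, .inr ()) => (k + 1, 1, 0)

lemma parametrize_injective {p : ℕ} (hp : p.Prime) : Function.Injective (parametrize p) := by
  have hp2 : (2 : ℤ) ≤ p := by exact_mod_cast hp.two_le
  have hk (k : ℕ) : (k : ℤ) + 1 ≠ 0 := by omega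
  have not_one (x y : ℤ) : (p : ℤ) * x ≠ p * y + 1 := fun h => by
    have : (p : ℤ) ∣ 1 := ⟨x - y, by linear_combination -h⟩
    have := Int.le_of_dvd one_pos this
    omega
  have not_one' (x y : ℤ) : (p : ℤ) ^ 2 * x ≠ p ^ 2 * y + 1 := fun h =>
    not_one (p * x) (p * y) (by linear_combination h)
  rintro ((⟨i, j⟩ | ⟨i, j⟩) | ⟨k, (i | i) | _⟩) ((⟨i', j'⟩ | ⟨i', j'⟩) | ⟨k', (i' | i') | _⟩) h <;>
    simp [parametrize, Fin.ext_iff, hp.ne_zero, hk, (hk _).symm, not_one, not_one',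
      (not_one _ _).symm, (not_one' _ _).symm] at h ⊢ <;>
    exact h

lemma exists_fin_eq_of_mul_add_mem_Ico {q r x : ℤ} {m : ℕ} (hr : 0 ≤ r) (hrq : r < q)
    (h : q * x + r ∈ Set.Ico 0 (q * m)) : ∃ i : Fin m, x = i := by
  obtain ⟨h0, hm⟩ := h
  have hx0 : 0 ≤ x := by
    by_contra! hx
    nlinarith
  have hxm : x < m := lt_of_mul_lt_mul_left (a := q) (by linarith) (by linarith)
  exact ⟨⟨x.toNat, by omega⟩, by simp [hx0]⟩

lemma mul_add_mem_Ico {q r : ℤ} {m : ℕ} (hr : 0 ≤ r) (hrq : r < q) (i : Fin m) :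
    q * (i : ℕ) + r ∈ Set.Ico 0 (q * m) := by
  have hi : ((i : ℕ) : ℤ) + 1 ≤ m := by exact_mod_cast i.2
  constructor <;> nlinarith [Int.natCast_nonneg (i : ℕ)]

lemma Prime.pow_dvd_or_pow_dvd_sub_one {p x : ℤ} (hp : Prime p) (n : ℕ)
    (h : p ^ n ∣ x * (x - 1)) : p ^ n ∣ x ∨ p ^ n ∣ x - 1 := by
  by_cases hx : p ∣ x
  · refine .inl (hp.pow_dvd_of_dvd_mul_right n (fun hx' => hp.not_dvd_one ?_) h)
    simpa using dvd_sub hx hx'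
  · exact .inr (hp.pow_dvd_of_dvd_mul_left n hx h)

lemma parametrize_mem {p : ℕ} (hp : p.Prime) (s) : parametrize p s ∈ subringParameters p := by
  have hp2 : (2 : ℤ) ≤ p := by exact_mod_cast hp.two_le
  have hq1 : (1 : ℤ) < p ^ 2 := by nlinarith
  have hc : (p : ℤ) ^ 3 = p ^ 2 * p := pow_succ _ _
  have hc1 : (1 : ℤ) < p ^ 3 := by nlinarith
  have h2 (i : Fin p) (r : ℤ) (hr : 0 ≤ r) (hr1 : r < 2) :
      (p : ℤ) ^ 2 * (i : ℕ) + r ∈ Set.Ico 0 ((p : ℤ) ^ 3) := by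
    rw [hc]
    exact mul_add_mem_Ico hr (by linarith) i
  have h1 (i : Fin (p ^ 2)) : (p : ℤ) * (i : ℕ) ∈ Set.Ico 0 ((p : ℤ) ^ 3) := by
    simpa [pow_succ'] using mul_add_mem_Ico (q := p) le_rfl (by linarith) i
  have h12 (i : Fin p) : (p : ℤ) * (p * (i : ℕ) + 1) ∈ Set.Ico 0 ((p : ℤ) ^ 3) := by
    have := mul_add_mem_Ico (q := p ^ 2) (r := p) (by linarith) (by nlinarith) i
    rw [hc]
    convert this using 1
    ring
  have hk (k : Fin (p - 1)) : ((k : ℕ) : ℤ) + 1 ∈ Set.Ico 0 (p : ℤ) := by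
    have := k.2
    constructor <;> omega
  have zero_mem : (0 : ℤ) ∈ Set.Ico 0 ((p : ℤ) ^ 3) := ⟨le_rfl, by linarith⟩
  have one_mem : (1 : ℤ) ∈ Set.Ico 0 ((p : ℤ) ^ 3) := ⟨by norm_num, hc1⟩
  rcases s with (⟨i, j⟩ | ⟨i, j⟩) | ⟨k, (i | i) | _⟩
  · refine ⟨⟨le_rfl, by simp [parametrize]; linarith⟩,
      by simpa [parametrize] using h2 i 0 le_rfl two_pos, h1 j, ?_⟩
    simp [parametrize]
    exact ⟨⟨_, mul_assoc _ _ _⟩, ⟨_, mul_assoc _ _ _⟩, j * (j - 1), by ring⟩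
  · refine ⟨⟨le_rfl, by simp [parametrize]; linarith⟩, h2 i 1 zero_le_one one_lt_two,
      by simpa [parametrize] using h2 j 0 le_rfl two_pos, ?_⟩
    simp [parametrize]
    exact ⟨⟨_, mul_left_comm _ _ _⟩, ⟨_, mul_left_comm _ _ _⟩, _, mul_assoc _ _ _⟩
  · refine ⟨hk k, zero_mem, by simpa [parametrize, sq, mul_assoc] using h2 i 0 le_rfl two_pos, ?_⟩
    simp [parametrize]
    exact ⟨⟨i * (p * i - 1) * p, by ring⟩, (k + 1) * i * (p * i - 1), by ring⟩
  · refine ⟨hk k, zero_mem, h12 i, ?_⟩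
    simp [parametrize]
    exact ⟨⟨(p * i + 1) * i * p, by ring⟩, (k + 1) * (p * i + 1) * i, by ring⟩
  · refine ⟨hk k, one_mem, zero_mem, ?_⟩
    simp [parametrize]

lemma range_parametrize {p : ℕ} (hp : p.Prime) :
    Set.range (parametrize p) = subringParameters p := by
  refine Set.Subset.antisymm (Set.range_subset_iff.2 (parametrize_mem hp)) ?_
  rintro ⟨a, c, e⟩ ⟨⟨ha0, hap⟩, hc, he, h⟩
  have hp' : Prime (p : ℤ) := Nat.prime_iff_prime_int.1 hp
  have hp2 : (2 : ℤ) ≤ p := by exact_mod_cast hp.two_le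
  have hq1 : (1 : ℤ) < p ^ 2 := by nlinarith
  have hc1 : (1 : ℤ) < p ^ 3 := by nlinarith
  have h32 : (p : ℤ) ^ 3 = p ^ 2 * p := pow_succ _ _
  have h31 : (p : ℤ) ^ 3 = p * ((p ^ 2 : ℕ) : ℤ) := by push_cast; ring
  have h30 : (p : ℤ) ^ 3 = p ^ 3 * ((1 : ℕ) : ℤ) := by simp
  simp only [Set.mem_insert_iff, Set.mem_singleton_iff, forall_eq_or_imp, forall_eq]
    at ha0 hap hc he h
  obtain ⟨⟨cc, acc⟩, ⟨ce, ace⟩, ee, aee⟩ := h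
  obtain ⟨y, rfl⟩ : (p : ℤ) ∣ e := by
    rcases hp'.dvd_or_dvd ((dvd_pow_self _ two_ne_zero).trans ee) with h | h
    · exact h
    · simpa using h
  rcases ha0.eq_or_lt with rfl | ha
  · rcases hp'.pow_dvd_or_pow_dvd_sub_one 2 cc with ⟨i, rfl⟩ | ⟨i, hi⟩
    · obtain ⟨i, rfl⟩ := exists_fin_eq_of_mul_add_mem_Ico (x := i) (m := p) le_rfl
        (zero_lt_one.trans hq1) (by rwa [add_zero, ← h32])
      obtain ⟨j, rfl⟩ := exists_fin_eq_of_mul_add_mem_Ico (x := y) (m := p ^ 2) le_rfl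
        (two_pos.trans_le hp2) (by rwa [add_zero, ← h31])
      exact ⟨.inl (.inl (i, j)), rfl⟩
    · obtain rfl : c = p ^ 2 * i + 1 := by linarith
      obtain ⟨i, rfl⟩ := exists_fin_eq_of_mul_add_mem_Ico (x := i) (m := p) zero_le_one
        hq1 (by rwa [← h32])
      have hpc : ¬ (p : ℤ) ∣ p ^ 2 * i + 1 := fun h =>
        hp'.not_dvd_one ((dvd_add_right (dvd_mul_of_dvd_left (dvd_pow_self _ two_ne_zero) _)).1 h)
      obtain ⟨j, hj⟩ := hp'.pow_dvd_of_dvd_mul_left 2 hpc ce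
      rw [hj] at he ⊢
      obtain ⟨j, rfl⟩ := exists_fin_eq_of_mul_add_mem_Ico (x := j) (m := p) le_rfl
        (zero_lt_one.trans hq1) (by rwa [add_zero, ← h32])
      exact ⟨.inl (.inr (i, j)), rfl⟩
  · obtain ⟨k, rfl⟩ : ∃ k : Fin (p - 1), a = k + 1 := ⟨⟨(a - 1).toNat, by omega⟩, by simp; omega⟩
    have hpa : ¬ (p : ℤ) ∣ (k : ℕ) + 1 := fun h => (Int.le_of_dvd ha h).not_gt hap
    rcases hp'.pow_dvd_or_pow_dvd_sub_one 3 (hp'.pow_dvd_of_dvd_mul_left 3 hpa acc)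
      with ⟨x, rfl⟩ | ⟨x, hx⟩
    · obtain ⟨x, rfl⟩ := exists_fin_eq_of_mul_add_mem_Ico (x := x) (m := 1) le_rfl
        (zero_lt_one.trans hc1) (by rwa [add_zero, ← h30])
      have hy : (p : ℤ) ^ 1 ∣ y * (y - 1) := by
        obtain ⟨z, hz⟩ := hp'.pow_dvd_of_dvd_mul_left 3 hpa aee
        exact ⟨z, mul_left_cancel₀ (pow_ne_zero 2 hp'.ne_zero) (by linear_combination hz)⟩
      rcases hp'.pow_dvd_or_pow_dvd_sub_one 1 hy with ⟨i, rfl⟩ | ⟨i, hi⟩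
      · obtain ⟨i, rfl⟩ := exists_fin_eq_of_mul_add_mem_Ico (q := p ^ 2) (x := i) (m := p) le_rfl
          (zero_lt_one.trans hq1) (by rw [← h32]; convert he using 1; ring)
        exact ⟨.inr (k, .inl (.inl i)), by simp [parametrize]⟩
      · obtain rfl : y = p * i + 1 := by linarith
        obtain ⟨i, rfl⟩ := exists_fin_eq_of_mul_add_mem_Ico (q := p ^ 2) (r := p) (x := i) (m := p)
          (by linarith) (by nlinarith) (by rw [← h32]; convert he using 1; ring)
        exact ⟨.inr (k, .inl (.inr i)), by simp [parametrize]⟩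
    · obtain rfl : c = p ^ 3 * x + 1 := by linarith
      obtain ⟨x, rfl⟩ := exists_fin_eq_of_mul_add_mem_Ico (x := x) (m := 1) zero_le_one
        hc1 (by rwa [← h30])
      obtain ⟨j, hj⟩ : (p : ℤ) ^ 3 ∣ p * y := by
        simpa using hp'.pow_dvd_of_dvd_mul_left 3 hpa ace
      rw [hj] at he ⊢
      obtain ⟨j, rfl⟩ := exists_fin_eq_of_mul_add_mem_Ico (x := j) (m := 1) le_rfl
        (zero_lt_one.trans hc1) (by rwa [add_zero, ← h30])
      exact ⟨.inr (k, .inr ()), by simp [parametrize]⟩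

lemma ncard_subringParameters {p : ℕ} (hp : p.Prime) :
    (subringParameters p).ncard = p * p ^ 2 + p * p + (p - 1) * (p + p + 1) := by
  rw [← range_parametrize hp, ← Nat.card_coe_set_eq,
    Nat.card_range_of_injective (parametrize_injective hp)]
  simp

lemma hermiteMatrix_injective {p : ℤ} (hp : p ≠ 0) :
    Function.Injective fun q : ℤ × ℤ × ℤ × ℤ × ℤ =>
      hermiteMatrix p q.2.2.1 q.1 q.2.2.2.1 q.2.1 q.2.2.2.2 := by
  rintro ⟨b, d, a, c, e⟩ ⟨b', d', a', c', e'⟩ h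
  have h01 := congrFun (congrFun h 0) 1
  have h02 := congrFun (congrFun h 0) 2
  have h03 := congrFun (congrFun h 0) 3
  have h12 := congrFun (congrFun h 1) 2
  have h13 := congrFun (congrFun h 1) 3
  simp [hermiteMatrix, hp] at h01 h02 h03 h12 h13
  simp [*]

theorem g_2412 (p : ℕ) (hp : p.Prime) :
    (gComp p ![2, 4, 1, 2] : ℤ) =
      (p : ℤ) ^ 5 + 3 * (p : ℤ) ^ 4 - (p : ℤ) ^ 3 - (p : ℤ) ^ 2 := by
  have hset : {A | IsIrreducibleSubringMatrix p ![2, 4, 1, 2] A} =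
      (fun q : ℤ × ℤ × ℤ × ℤ × ℤ => hermiteMatrix p q.2.2.1 q.1 q.2.2.2.1 q.2.1 q.2.2.2.2) ''
        (Set.Ico (0 : ℤ) p ×ˢ Set.Ico (0 : ℤ) p ×ˢ subringParameters p) := by
    ext A
    simp only [Set.mem_ofPred_eq, isIrreducibleSubringMatrix_iff_s13 hp, Set.mem_image, Set.mem_prod,
      Prod.exists]
    constructor
    · rintro ⟨b, hb, d, hd, a, c, e, h, rfl⟩
      exact ⟨b, d, a, c, e, ⟨hb, hd, h⟩, rfl⟩
    · rintro ⟨b, d, a, c, e, ⟨hb, hd, h⟩, rfl⟩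
      exact ⟨b, hb, d, hd, a, c, e, h, rfl⟩
  have hcard : gComp p ![2, 4, 1, 2] =
      p * (p * (p * p ^ 2 + p * p + (p - 1) * (p + p + 1))) := by
    have hIco : (Set.Ico (0 : ℤ) p).ncard = p := by
      rw [← Finset.coe_Ico, Set.ncard_coe_finset, Int.card_Ico]
      simp
    change Nat.card {A | IsIrreducibleSubringMatrix p ![2, 4, 1, 2] A} = _
    rw [hset, Nat.card_coe_set_eq, Set.ncard_image_of_injective _
      (hermiteMatrix_injective (by exact_mod_cast hp.ne_zero)), Set.ncard_prod, Set.ncard_prod,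
      hIco, ncard_subringParameters hp]
  rw [hcard]
  push_cast [hp.one_le]
  ring
end

section
/- For every prime p, g_{(2,1,2,2,2)}(p) = 2p^5 − p^3, where (2,1,2,2,2) is the composition of 9 into 5 positive parts with entries 2, 1, 2, 2, 2 in that order (so the corresponding irreducible subring matrices have size n = 6). -/
/-- The entries, divided by `p`, which are not forced in an irreducible subring matrix with
diagonal `(p ^ 2, p, p ^ 2, p ^ 2, p ^ 2, 1)`. -/
@[ext]
structure Coeffs (R : Type*) where
  a01 : R
  a02 : R
  a03 : R
  a04 : R
  a23 : R
  a24 : R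
  a34 : R

namespace Coeffs

/-- The polynomial equations expressing multiplicative closure modulo `p`. -/
def Admissible {R : Type*} [CommRing R] (c : Coeffs R) : Prop :=
  c.a02 * c.a23 = 0 ∧ c.a23 * c.a34 = 0 ∧ c.a03 * c.a34 ^ 2 + c.a02 * c.a24 ^ 2 = 0

/-- Apply a function to all coefficients. -/
def map {R S : Type*} (f : R → S) (c : Coeffs R) : Coeffs S :=
  ⟨f c.a01, f c.a02, f c.a03, f c.a04, f c.a23, f c.a24, f c.a34⟩

/-- The candidate irreducible subring matrix with the given coefficients. -/
def toMatrix (p : ℤ) (c : Coeffs ℤ) : Matrix (Fin 6) (Fin 6) ℤ :=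
  !![p ^ 2, p * c.a01, p * c.a02, p * c.a03, p * c.a04, 1;
     0, p, 0, 0, 0, 1;
     0, 0, p ^ 2, p * c.a23, p * c.a24, 1;
     0, 0, 0, p ^ 2, p * c.a34, 1;
     0, 0, 0, 0, p ^ 2, 1;
     0, 0, 0, 0, 0, 1]

lemma inColSpan_toMatrix_iff (p : ℤ) (c : Coeffs ℤ) (v : Fin 6 → ℤ) :
    InColSpan (c.toMatrix p) v ↔ ∃ x₀ x₁ x₂ x₃ x₄ x₅ : ℤ,
      p ^ 2 * x₀ + p * c.a01 * x₁ + p * c.a02 * x₂ + p * c.a03 * x₃ + p * c.a04 * x₄ + x₅ = v 0 ∧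
      p * x₁ + x₅ = v 1 ∧
      p ^ 2 * x₂ + p * c.a23 * x₃ + p * c.a24 * x₄ + x₅ = v 2 ∧
      p ^ 2 * x₃ + p * c.a34 * x₄ + x₅ = v 3 ∧
      p ^ 2 * x₄ + x₅ = v 4 ∧
      x₅ = v 5 := by
  constructor
  · rintro ⟨x, rfl⟩
    refine ⟨x 0, x 1, x 2, x 3, x 4, x 5, ?_⟩
    simp [toMatrix, Matrix.mulVec, dotProduct, Fin.sum_univ_six]
  · rintro ⟨x₀, x₁, x₂, x₃, x₄, x₅, h₀, h₁, h₂, h₃, h₄, h₅⟩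
    refine ⟨![x₀, x₁, x₂, x₃, x₄, x₅], ?_⟩
    ext i
    fin_cases i <;>
      simp [toMatrix, Matrix.mulVec, dotProduct, Fin.sum_univ_six, ← h₀, ← h₁, ← h₂, ← h₃, ← h₄,
        ← h₅]

lemma inColSpan_mul_toMatrix {p : ℤ} {c : Coeffs ℤ} (h₁ : p ∣ c.a02 * c.a23)
    (h₂ : c.a23 * c.a34 = 0) (h₃ : p ∣ c.a03 * c.a34 ^ 2 + c.a02 * c.a24 ^ 2) (j k : Fin 6) :
    InColSpan (c.toMatrix p) (fun i => c.toMatrix p i j * c.toMatrix p i k) := by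
  wlog hjk : j ≤ k generalizing j k
  · simpa only [mul_comm] using this k j (le_of_not_ge hjk)
  obtain ⟨m, hm⟩ := h₁
  obtain ⟨n, hn⟩ := h₃
  obtain ⟨b01, b02, b03, b04, b23, b24, b34⟩ := c
  rw [inColSpan_toMatrix_iff]
  simp only at h₂ hm hn
  fin_cases j <;> fin_cases k <;>
    first
    | (exfalso; revert hjk; decide)
    | simp only [toMatrix, Fin.zero_eta, Fin.mk_one, Fin.reduceFinMk, Matrix.of_apply,
        Matrix.cons_val, mul_zero, mul_one, zero_mul]
  · exact ⟨p ^ 2, 0, 0, 0, 0, 0, by ring, by ring, by ring, by ring, by ring, rfl⟩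
  · exact ⟨p * b01, 0, 0, 0, 0, 0, by ring, by ring, by ring, by ring, by ring, rfl⟩
  · exact ⟨p * b02, 0, 0, 0, 0, 0, by ring, by ring, by ring, by ring, by ring, rfl⟩
  · exact ⟨p * b03, 0, 0, 0, 0, 0, by ring, by ring, by ring, by ring, by ring, rfl⟩
  · exact ⟨p * b04, 0, 0, 0, 0, 0, by ring, by ring, by ring, by ring, by ring, rfl⟩
  · exact ⟨1, 0, 0, 0, 0, 0, by ring, by ring, by ring, by ring, by ring, rfl⟩
  · exact ⟨b01 ^ 2 - b01, p, 0, 0, 0, 0, by ring, by ring, by ring, by ring, by ring, rfl⟩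
  · exact ⟨b01 * b02, 0, 0, 0, 0, 0, by ring, by ring, by ring, by ring, by ring, rfl⟩
  · exact ⟨b01 * b03, 0, 0, 0, 0, 0, by ring, by ring, by ring, by ring, by ring, rfl⟩
  · exact ⟨b01 * b04, 0, 0, 0, 0, 0, by ring, by ring, by ring, by ring, by ring, rfl⟩
  · exact ⟨0, 1, 0, 0, 0, 0, by ring, by ring, by ring, by ring, by ring, rfl⟩
  · exact ⟨b02 ^ 2 - p * b02, 0, p ^ 2, 0, 0, 0,
      by ring, by ring, by ring, by ring, by ring, rfl⟩
  · exact ⟨b02 * b03 - b02 * b23, 0, p * b23, 0, 0, 0,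
      by ring, by ring, by ring, by ring, by ring, rfl⟩
  · exact ⟨b02 * b04 - b02 * b24, 0, p * b24, 0, 0, 0,
      by ring, by ring, by ring, by ring, by ring, rfl⟩
  · exact ⟨0, 0, 1, 0, 0, 0, by ring, by ring, by ring, by ring, by ring, rfl⟩
  · exact ⟨b03 ^ 2 - p * b03 - b23 * m + b02 * b23, 0, b23 ^ 2 - p * b23, p ^ 2, 0, 0,
      by linear_combination p * b23 * hm, by ring, by ring, by ring, by ring, rfl⟩
  · exact ⟨b03 * b04 - b03 * b34 - m * (b24 - b34), 0, b23 * b24 - b23 * b34, p * b34, 0, 0,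
      by linear_combination p * (b24 - b34) * hm, by ring, by ring, by ring, by ring, rfl⟩
  · exact ⟨0, 0, 0, 1, 0, 0, by ring, by ring, by ring, by ring, by ring, rfl⟩
  · exact ⟨b04 ^ 2 - n + b02 * b24 + b03 * b34 - p * b04, 0, b24 ^ 2 - p * b24,
      b34 ^ 2 - p * b34, p ^ 2, 0,
      by linear_combination p * hn, by ring, by linear_combination (p * b34 - p ^ 2) * h₂,
      by ring, by ring, rfl⟩
  · exact ⟨0, 0, 0, 0, 1, 0, by ring, by ring, by ring, by ring, by ring, rfl⟩
  · exact ⟨0, 0, 0, 0, 0, 1, by ring, by ring, by ring, by ring, by ring, rfl⟩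

lemma dvd_of_inColSpan_mul_toMatrix {p : ℤ} (hp : Prime p) {c : Coeffs ℤ}
    (h : ∀ j k : Fin 6, InColSpan (c.toMatrix p) (fun i => c.toMatrix p i j * c.toMatrix p i k)) :
    p ∣ c.a02 * c.a23 ∧ p ∣ c.a23 * c.a34 ∧
      (c.a23 * c.a34 = 0 → p ∣ c.a03 * c.a34 ^ 2 + c.a02 * c.a24 ^ 2) := by
  have h0 : p ≠ 0 := hp.ne_zero
  obtain ⟨b01, b02, b03, b04, b23, b24, b34⟩ := c
  have h33 := h 3 3
  have h44 := h 4 4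
  rw [inColSpan_toMatrix_iff] at h33 h44
  simp only [toMatrix, Matrix.of_apply, Matrix.cons_val, mul_zero] at h33 h44 ⊢
  obtain ⟨x₀, x₁, x₂, x₃, x₄, x₅, e₀, e₁, e₂, e₃, e₄, rfl⟩ := h33
  obtain ⟨y₀, y₁, y₂, y₃, y₄, y₅, f₀, f₁, f₂, f₃, f₄, rfl⟩ := h44
  have hx₄ : x₄ = 0 := by simpa [h0] using e₄
  have hx₁ : x₁ = 0 := by simpa [h0] using e₁
  subst hx₄ hx₁
  have hx₃ : x₃ = p ^ 2 := mul_left_cancel₀ (pow_ne_zero 2 h0) (by linear_combination e₃)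
  subst hx₃
  have hx₂ : x₂ = b23 ^ 2 - p * b23 :=
    mul_left_cancel₀ (pow_ne_zero 2 h0) (by linear_combination e₂)
  subst hx₂
  have hy₁ : y₁ = 0 := by simpa [h0] using f₁
  have hy₄ : y₄ = p ^ 2 := mul_left_cancel₀ (pow_ne_zero 2 h0) (by linear_combination f₄)
  subst hy₁ hy₄
  have hy₃ : y₃ = b34 ^ 2 - p * b34 :=
    mul_left_cancel₀ (pow_ne_zero 2 h0) (by linear_combination f₃)
  subst hy₃
  refine ⟨?_, ?_, fun hz => ?_⟩
  · have : p ∣ (b02 * b23) * b23 :=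
      ⟨b03 ^ 2 - p * b03 + b02 * b23 - x₀, mul_left_cancel₀ h0 (by linear_combination e₀)⟩
    rcases hp.dvd_or_dvd this with h | h
    · exact h
    · exact h.mul_left _
  · have : p ∣ (b23 * b34) * b34 :=
      ⟨b24 ^ 2 - p * b24 + b23 * b34 - y₂, mul_left_cancel₀ h0 (by linear_combination f₂)⟩
    rcases hp.dvd_or_dvd this with h | h
    · exact h
    · exact h.mul_left _
  · have hy₂ : y₂ = b24 ^ 2 - p * b24 :=
      mul_left_cancel₀ (pow_ne_zero 2 h0) (by linear_combination f₂ + (p ^ 2 - p * b34) * hz)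
    subst hy₂
    exact ⟨b04 ^ 2 - p * b04 + b02 * b24 + b03 * b34 - y₀,
      mul_left_cancel₀ h0 (by linear_combination f₀)⟩

variable {p : ℕ}

/-- The candidate irreducible subring matrix with coefficients lifted from `ZMod p`. -/
def liftMatrix (c : Coeffs (ZMod p)) : Matrix (Fin 6) (Fin 6) ℤ :=
  (c.map fun x => (x.val : ℤ)).toMatrix p

lemma dvd_val_mul_iff [NeZero p] (x y : ZMod p) :
    (p : ℤ) ∣ x.val * y.val ↔ x * y = 0 := by
  rw [← ZMod.intCast_zmod_eq_zero_iff_dvd]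
  simp

lemma admissible_iff_isIrreducibleSubringMatrix (hp : p.Prime) (c : Coeffs (ZMod p)) :
    c.Admissible ↔ IsIrreducibleSubringMatrix p ![2, 1, 2, 2, 2] c.liftMatrix := by
  have : Fact p.Prime := ⟨hp⟩
  have hdvd : (p : ℤ) ∣ c.a03.val * c.a34.val ^ 2 + c.a02.val * c.a24.val ^ 2 ↔
      c.a03 * c.a34 ^ 2 + c.a02 * c.a24 ^ 2 = 0 := by
    rw [← ZMod.intCast_zmod_eq_zero_iff_dvd]
    simp
  have hzero : c.a23 * c.a34 = 0 → (c.a23.val : ℤ) * c.a34.val = 0 := by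
    rw [mul_eq_zero]
    rintro (h | h) <;> simp [h]
  constructor
  · rintro ⟨h₁, h₂, h₃⟩
    have hp0 : (0 : ℤ) < p := by exact_mod_cast hp.pos
    have hlt (x : ZMod p) : 0 ≤ (p : ℤ) * x.val ∧ (p : ℤ) * x.val < p ^ 2 := by
      have : (x.val : ℤ) < p := by exact_mod_cast x.val_lt
      exact ⟨by positivity, by nlinarith⟩
    have hone : (1 : ℤ) < p := by exact_mod_cast hp.one_lt
    have hsq : (1 : ℤ) < p ^ 2 := by nlinarith
    refine ⟨⟨?_, ?_, ?_, ?_, inColSpan_mul_toMatrix ((dvd_val_mul_iff _ _).2 h₁) (hzero h₂)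
      (hdvd.2 h₃)⟩, ?_, ?_, ?_, ?_⟩
    · intro i j hij
      fin_cases i <;> fin_cases j <;>
        first
        | rfl
        | exact absurd hij (by decide)
    · intro i
      fin_cases i <;> simp [liftMatrix, toMatrix, hp.pos, zero_lt_one.trans hsq]
    · intro i j hij
      fin_cases i <;> fin_cases j <;>
        first
        | exact absurd hij (by decide)
        | exact hlt _
        | simp [liftMatrix, toMatrix, hp.pos, hp.one_lt, hsq]
    · refine (inColSpan_toMatrix_iff _ _ _).2 ⟨0, 0, 0, 0, 0, 1, ?_⟩
      simp
    · intro i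
      fin_cases i <;> simp [liftMatrix, toMatrix]
    · rfl
    · intro i
      fin_cases i <;> rfl
    · intro i j hij
      fin_cases i <;> fin_cases j <;>
        first
        | exact absurd hij (by decide)
        | simp [liftMatrix, toMatrix]
  · rintro ⟨⟨-, -, -, -, h⟩, -⟩
    obtain ⟨h₁, h₂, h₃⟩ := dvd_of_inColSpan_mul_toMatrix (Nat.prime_iff_prime_int.1 hp) h
    have h₂' := (dvd_val_mul_iff _ _).1 h₂
    exact ⟨(dvd_val_mul_iff _ _).1 h₁, h₂', hdvd.1 (h₃ (hzero h₂'))⟩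

lemma liftMatrix_injective (hp : p.Prime) :
    Function.Injective (liftMatrix : Coeffs (ZMod p) → _) := by
  have : Fact p.Prime := ⟨hp⟩
  intro c d h
  have key (i j : Fin 6) {x y : ZMod p} (hx : c.liftMatrix i j = p * x.val)
      (hy : d.liftMatrix i j = p * y.val) : x = y := by
    have hxy : (p : ℤ) * x.val = p * y.val := by rw [← hx, ← hy, h]
    exact ZMod.val_injective p
      (by exact_mod_cast mul_left_cancel₀ (by exact_mod_cast hp.ne_zero) hxy)
  ext1
  exacts [key 0 1 rfl rfl, key 0 2 rfl rfl, key 0 3 rfl rfl, key 0 4 rfl rfl, key 2 3 rfl rfl,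
    key 2 4 rfl rfl, key 3 4 rfl rfl]

lemma exists_eq_liftMatrix (hp : p.Prime) {A : Matrix (Fin 6) (Fin 6) ℤ}
    (hA : IsIrreducibleSubringMatrix p ![2, 1, 2, 2, 2] A) :
    ∃ c : Coeffs (ZMod p), c.liftMatrix = A := by
  have : Fact p.Prime := ⟨hp⟩
  obtain ⟨⟨hlow, -, hbd, -⟩, hdiag, -, hlast, hdvd⟩ := hA
  have hp0 : (0 : ℤ) < p := by exact_mod_cast hp.pos
  have key (i j : Fin 5) (hij : i < j) (hi : A i.castSucc i.castSucc = (p : ℤ) ^ 2) :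
      ∃ x : ZMod p, A i.castSucc j.castSucc = p * x.val := by
    obtain ⟨k, hk⟩ := hdvd i j hij
    obtain ⟨h0, h1⟩ := hbd i.castSucc j.castSucc hij
    rw [hi] at h1
    rw [hk] at h0 h1
    have hk0 : 0 ≤ k := nonneg_of_mul_nonneg_right h0 hp0
    have hk1 : k < p := by nlinarith
    refine ⟨(k : ZMod p), ?_⟩
    rw [hk, ZMod.val_intCast, Int.emod_eq_of_lt hk0 hk1]
  have hrow (j : Fin 5) (hj : 1 < j) : A 1 j.castSucc = 0 := by
    obtain ⟨h0, h1⟩ := hbd 1 j.castSucc hj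
    have h11 : A 1 1 = p := by simpa using hdiag 1
    exact Int.eq_zero_of_dvd_of_nonneg_of_lt h0 (h11 ▸ h1) (hdvd 1 j hj)
  obtain ⟨b01, h01⟩ := key 0 1 (by decide) (hdiag 0)
  obtain ⟨b02, h02⟩ := key 0 2 (by decide) (hdiag 0)
  obtain ⟨b03, h03⟩ := key 0 3 (by decide) (hdiag 0)
  obtain ⟨b04, h04⟩ := key 0 4 (by decide) (hdiag 0)
  obtain ⟨b23, h23⟩ := key 2 3 (by decide) (hdiag 2)
  obtain ⟨b24, h24⟩ := key 2 4 (by decide) (hdiag 2)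
  obtain ⟨b34, h34⟩ := key 3 4 (by decide) (hdiag 3)
  refine ⟨⟨b01, b02, b03, b04, b23, b24, b34⟩, ?_⟩
  ext i j
  fin_cases i <;> fin_cases j <;>
    first
    | exact (hlow _ _ (by decide)).symm
    | exact (hlast _).symm
    | exact h01.symm
    | exact h02.symm
    | exact h03.symm
    | exact h04.symm
    | exact h23.symm
    | exact h24.symm
    | exact h34.symm
    | exact (hrow 2 (by decide)).symm
    | exact (hrow 3 (by decide)).symm
    | exact (hrow 4 (by decide)).symm
    | exact (hdiag 0).symm
    | exact ((hdiag 1).trans (pow_one _)).symm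
    | exact (hdiag 2).symm
    | exact (hdiag 3).symm
    | exact (hdiag 4).symm

variable {F : Type*} [Field F]

/-- A parametrization of the admissible coefficients over a field. -/
def ofParam : (F × F) × ((Fˣ × F × F) ⊕ (F × F) ⊕ (Fˣ × F × F) ⊕ (Fˣ × F)) → Coeffs F
  | ((x, y), .inl (u, s, t)) => ⟨x, 0, s, y, u, t, 0⟩
  | ((x, y), .inr (.inl (s, t))) => ⟨x, s, t, y, 0, 0, 0⟩
  | ((x, y), .inr (.inr (.inl (u, s, t)))) => ⟨x, s, -s * t ^ 2 / (u : F) ^ 2, y, 0, t, u⟩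
  | ((x, y), .inr (.inr (.inr (u, s)))) => ⟨x, 0, s, y, 0, u, 0⟩

lemma ofParam_injective : Function.Injective (ofParam (F := F)) := by
  rintro ⟨⟨x, y⟩, ⟨u, s, t⟩ | ⟨s, t⟩ | ⟨u, s, t⟩ | ⟨u, s⟩⟩
    ⟨⟨x', y'⟩, ⟨u', s', t'⟩ | ⟨s', t'⟩ | ⟨u', s', t'⟩ | ⟨u', s'⟩⟩ h <;>
  simp_all [ofParam, Units.ext_iff, eq_comm]

lemma range_ofParam : Set.range (ofParam (F := F)) = {c | c.Admissible} := by
  ext ⟨b01, b02, b03, b04, b23, b24, b34⟩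
  constructor
  · rintro ⟨⟨⟨x, y⟩, ⟨u, s, t⟩ | ⟨s, t⟩ | ⟨u, s, t⟩ | ⟨u, s⟩⟩, h⟩ <;> rw [← h] <;>
      simp [ofParam, Admissible]
  · rintro ⟨h₁, h₂, h₃⟩
    simp only at h₁ h₂ h₃
    by_cases h23 : b23 = 0
    · subst h23
      by_cases h34 : b34 = 0
      · subst h34
        by_cases h24 : b24 = 0
        · subst h24
          exact ⟨((b01, b04), .inr (.inl (b02, b03))), rfl⟩
        · have h02 : b02 = 0 := by simpa [h24] using h₃
          subst h02
          exact ⟨((b01, b04), .inr (.inr (.inr (Units.mk0 b24 h24, b03)))), rfl⟩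
      · refine ⟨((b01, b04), .inr (.inr (.inl (Units.mk0 b34 h34, b02, b24)))), ?_⟩
        simp only [ofParam, Units.val_mk0, mk.injEq, true_and, and_true]
        rw [div_eq_iff (pow_ne_zero 2 h34)]
        linear_combination -h₃
    · have h02 : b02 = 0 := by simpa [h23] using h₁
      have h34 : b34 = 0 := by simpa [h23] using h₂
      subst h02 h34
      exact ⟨((b01, b04), .inl (Units.mk0 b23 h23, b03, b24)), rfl⟩

lemma card_admissible [Finite F] : (Nat.card {c : Coeffs F // c.Admissible} : ℤ) =
    2 * (Nat.card F : ℤ) ^ 5 - (Nat.card F : ℤ) ^ 3 := by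
  have h := Nat.card_range_of_injective (ofParam_injective (F := F))
  rw [range_ofParam] at h
  have hpos : 1 ≤ Nat.card F := Nat.card_pos
  rw [← Set.coe_ofPred, h]
  simp only [Nat.card_prod, Nat.card_sum, Nat.card_units]
  push_cast [hpos]
  ring

end Coeffs

theorem g_21222 (p : ℕ) (hp : p.Prime) :
    (gComp p ![2, 1, 2, 2, 2] : ℤ) = 2 * (p : ℤ) ^ 5 - (p : ℤ) ^ 3 := by
  have : Fact p.Prime := ⟨hp⟩
  have e : {c : Coeffs (ZMod p) // c.Admissible} ≃
      {A : Matrix (Fin 6) (Fin 6) ℤ // IsIrreducibleSubringMatrix p ![2, 1, 2, 2, 2] A} :=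
    Equiv.ofBijective
      (fun c => ⟨c.1.liftMatrix, (Coeffs.admissible_iff_isIrreducibleSubringMatrix hp c.1).1 c.2⟩)
      ⟨fun c d h => Subtype.ext (Coeffs.liftMatrix_injective hp (congrArg Subtype.val h)), by
        rintro ⟨A, hA⟩
        obtain ⟨c, rfl⟩ := Coeffs.exists_eq_liftMatrix hp hA
        exact ⟨⟨c, (Coeffs.admissible_iff_isIrreducibleSubringMatrix hp c).2 hA⟩, rfl⟩⟩
  rw [gComp, ← Nat.card_congr e, Coeffs.card_admissible, Nat.card_zmod]
end

section
/- For every prime p, g_{(3,1,3,2)}(p) = 2p^4, where (3,1,3,2) is the composition of 9 into 4 positive parts with entries 3, 1, 3, 2 in that order (so the corresponding irreducible subring matrices have size n = 5). -/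
/-- The upper triangular matrix with diagonal `(q ^ 3, q, q ^ 3, q ^ 2, 1)`, last column `1`,
and the four free off-diagonal entries `a`, `b`, `c`, `d`. -/
def matrix3132 (q a b c d : ℤ) : Matrix (Fin 5) (Fin 5) ℤ :=
  !![q ^ 3, a, b, c, 1;
     0, q, 0, 0, 1;
     0, 0, q ^ 3, d, 1;
     0, 0, 0, q ^ 2, 1;
     0, 0, 0, 0, 1]

theorem inColSpan_matrix3132_iff (q a b c d : ℤ) (v : Fin 5 → ℤ) :
    InColSpan (matrix3132 q a b c d) v ↔ ∃ x₀ x₁ x₂ x₃ x₄ : ℤ,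
      q ^ 3 * x₀ + a * x₁ + b * x₂ + c * x₃ + x₄ = v 0 ∧ q * x₁ + x₄ = v 1 ∧
      q ^ 3 * x₂ + d * x₃ + x₄ = v 2 ∧ q ^ 2 * x₃ + x₄ = v 3 ∧ x₄ = v 4 := by
  constructor
  · rintro ⟨x, hx⟩
    refine ⟨x 0, x 1, x 2, x 3, x 4, ?_⟩
    simp [← hx, matrix3132, dotProduct, Fin.sum_univ_succ, Fin.succ]
    grind
  · rintro ⟨x₀, x₁, x₂, x₃, x₄, h₀, h₁, h₂, h₃, h₄⟩
    refine ⟨![x₀, x₁, x₂, x₃, x₄], ?_⟩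
    ext i
    fin_cases i <;> simp [matrix3132, Matrix.mulVec, dotProduct, Fin.sum_univ_succ] <;> grind

/-- Closure under products of columns only has to be checked for the columns `1`, `2`, `3`: the
column `0` is a multiple of a unit vector, and the column `4` is constant. -/
theorem inColSpan_mul_matrix3132 {q a b c d : ℤ}
    (h₁₁ : InColSpan (matrix3132 q a b c d) ![a * a, q * q, 0, 0, 0])
    (h₁₂ : InColSpan (matrix3132 q a b c d) ![a * b, 0, 0, 0, 0])
    (h₁₃ : InColSpan (matrix3132 q a b c d) ![a * c, 0, 0, 0, 0])
    (h₂₂ : InColSpan (matrix3132 q a b c d) ![b * b, 0, q ^ 3 * q ^ 3, 0, 0])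
    (h₂₃ : InColSpan (matrix3132 q a b c d) ![b * c, 0, q ^ 3 * d, 0, 0])
    (h₃₃ : InColSpan (matrix3132 q a b c d) ![c * c, 0, d * d, q ^ 2 * q ^ 2, 0])
    (j k : Fin 5) :
    InColSpan (matrix3132 q a b c d)
      (fun i => matrix3132 q a b c d i j * matrix3132 q a b c d i k) := by
  have inCol0 : ∀ t : ℤ, InColSpan (matrix3132 q a b c d) ![q ^ 3 * t, 0, 0, 0, 0] := fun t =>
    (inColSpan_matrix3132_iff ..).2 ⟨t, 0, 0, 0, 0, by simp⟩
  have col4 : ∀ i, matrix3132 q a b c d i 4 = 1 := by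
    intro i; fin_cases i <;> rfl
  wlog hjk : j ≤ k generalizing j k
  · simpa only [mul_comm] using this k j (le_of_not_ge hjk)
  by_cases hk : k = 4
  · subst hk
    simpa only [col4, mul_one] using inColSpan_col (matrix3132 q a b c d) j
  by_cases hj : j = 0
  · subst hj
    convert inCol0 (matrix3132 q a b c d 0 k) using 1
    ext i; fin_cases i <;> simp [matrix3132]
  fin_cases j <;> fin_cases k <;> first
    | exact absurd rfl hj
    | exact absurd rfl hk
    | exact absurd hjk (by decide)
    | (convert h₁₁ using 1; ext i; fin_cases i <;> simp [matrix3132]; done)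
    | (convert h₁₂ using 1; ext i; fin_cases i <;> simp [matrix3132]; done)
    | (convert h₁₃ using 1; ext i; fin_cases i <;> simp [matrix3132]; done)
    | (convert h₂₂ using 1; ext i; fin_cases i <;> simp [matrix3132]; done)
    | (convert h₂₃ using 1; ext i; fin_cases i <;> simp [matrix3132]; done)
    | (convert h₃₃ using 1; ext i; fin_cases i <;> simp [matrix3132])

theorem isIrreducibleSubringMatrix_matrix3132 {p : ℕ} (hp : p.Prime) {e k x y z : ℤ}
    (he : e = 0 ∨ e = 1) (hk : 0 ≤ k ∧ k < p) (hx : 0 ≤ x ∧ x < p) (hy : 0 ≤ y ∧ y < p)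
    (hz : 0 ≤ z ∧ z < p) :
    IsIrreducibleSubringMatrix p ![3, 1, 3, 2]
      (matrix3132 p (p * (e + p * k)) (p ^ 2 * x) (p ^ 2 * y) (p ^ 2 * z)) := by
  have hp2 : (2 : ℤ) ≤ p := by exact_mod_cast hp.two_le
  unfold IsIrreducibleSubringMatrix
  generalize (p : ℤ) = q at *
  have hq0 : 0 < q := by omega
  have hq2 : 0 < q ^ 2 := by positivity
  have he2 : e * e = e := by rcases he with rfl | rfl <;> rfl
  have bound : ∀ t : ℤ, 0 ≤ t ∧ t < q → 0 ≤ q ^ 2 * t ∧ q ^ 2 * t < q ^ 3 := fun t ht =>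
    ⟨mul_nonneg hq2.le ht.1, by nlinarith⟩
  have hea : 0 ≤ q * (e + q * k) ∧ q * (e + q * k) < q ^ 3 := by
    have h0 : 0 ≤ e := by omega
    have h0' : e ≤ 1 := by omega
    have h1 : e + q * k < q * q := by nlinarith [hk.2]
    have hqk : 0 ≤ q * k := mul_nonneg hq0.le hk.1
    exact ⟨by positivity, by nlinarith⟩
  have hz2 : 0 ≤ q ^ 2 * z ∧ q ^ 2 * z < q ^ 3 := bound z hz
  have hx2 := bound x hx
  have hy2 := bound y hy
  have hone : (1 : ℤ) < q := by omega
  refine ⟨⟨?_, ?_, ?_, ?_, ?_⟩, ?_, rfl, ?_, ?_⟩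
  · intro i j hij
    fin_cases i <;> fin_cases j <;> first | rfl | exact absurd hij (by decide)
  · intro i
    fin_cases i <;> simp [matrix3132, hq0]
  · intro i j hij
    fin_cases i <;> fin_cases j <;> first
      | exact absurd hij (by decide)
      | exact hea
      | exact hx2
      | exact hy2
      | exact hz2
      | simp [matrix3132, hq0, one_lt_pow₀ hone, hone]
  · exact (inColSpan_matrix3132_iff ..).2 ⟨0, 0, 0, 0, 1, by simp⟩
  · apply inColSpan_mul_matrix3132 <;> rw [inColSpan_matrix3132_iff]
    · refine ⟨2 * e * k + q * k ^ 2 - k, q, 0, 0, 0, ?_⟩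
      simp
      linear_combination (-q ^ 2) * he2
    · exact ⟨(e + q * k) * x, 0, 0, 0, 0, by simp; ring⟩
    · exact ⟨(e + q * k) * y, 0, 0, 0, 0, by simp; ring⟩
    · exact ⟨q * x ^ 2 - q ^ 2 * x, 0, q ^ 3, 0, 0, by simp; ring⟩
    · exact ⟨q * (x * y - z * x), 0, q ^ 2 * z, 0, 0, by simp; ring⟩
    · refine ⟨q * y ^ 2 - q * y - (z ^ 2 - z) * x, 0, q * (z ^ 2 - z), q ^ 2, 0, ?_⟩
      simp
      constructor <;> ring
  · intro i
    fin_cases i <;> simp [matrix3132]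
  · intro i
    fin_cases i <;> rfl
  · intro i j hij
    fin_cases i <;> fin_cases j <;> first
      | exact absurd hij (by decide)
      | simp [matrix3132, dvd_mul_of_dvd_left]

theorem exists_eq_matrix3132 {p : ℕ} (hp : p.Prime) {A : Matrix (Fin 5) (Fin 5) ℤ}
    (hA : IsIrreducibleSubringMatrix p ![3, 1, 3, 2] A) :
    ∃ e k x y z : ℤ, (e = 0 ∨ e = 1) ∧ (0 ≤ k ∧ k < p) ∧ (0 ≤ x ∧ x < p) ∧ (0 ≤ y ∧ y < p) ∧
      (0 ≤ z ∧ z < p) ∧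
      A = matrix3132 p (p * (e + p * k)) (p ^ 2 * x) (p ^ 2 * y) (p ^ 2 * z) := by
  have hp' : Prime (p : ℤ) := Nat.prime_iff_prime_int.1 hp
  obtain ⟨⟨htri, -, hbd, -, hmul⟩, hdiag, -, hlast, hdvd⟩ := hA
  have hq0 : (0 : ℤ) < p := by exact_mod_cast hp.pos
  have diag0 : A 0 0 = (p : ℤ) ^ 3 := hdiag 0
  have diag1 : A 1 1 = (p : ℤ) := by simpa using hdiag 1
  have diag2 : A 2 2 = (p : ℤ) ^ 3 := hdiag 2
  have diag3 : A 3 3 = (p : ℤ) ^ 2 := hdiag 3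
  have row1 : ∀ j, 0 ≤ A 1 j ∧ A 1 j < A 1 1 → (p : ℤ) ∣ A 1 j → A 1 j = 0 := fun j h hd =>
    Int.eq_zero_of_dvd_of_nonneg_of_lt h.1 (diag1 ▸ h.2) hd
  have h12 : A 1 2 = 0 := row1 2 (hbd 1 2 (by decide)) (hdvd 1 2 (by decide))
  have h13 : A 1 3 = 0 := row1 3 (hbd 1 3 (by decide)) (hdvd 1 3 (by decide))
  obtain ⟨a, ha⟩ : (p : ℤ) ∣ A 0 1 := hdvd 0 1 (by decide)
  obtain ⟨b, hb⟩ : (p : ℤ) ∣ A 0 2 := hdvd 0 2 (by decide)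
  obtain ⟨c, hc⟩ : (p : ℤ) ∣ A 0 3 := hdvd 0 3 (by decide)
  obtain ⟨d, hd⟩ : (p : ℤ) ∣ A 2 3 := hdvd 2 3 (by decide)
  have bda := hbd 0 1 (by decide)
  have bdb := hbd 0 2 (by decide)
  have bdc := hbd 0 3 (by decide)
  have bdd := hbd 2 3 (by decide)
  rw [diag0, ha] at bda
  rw [diag0, hb] at bdb
  rw [diag0, hc] at bdc
  rw [diag2, hd] at bdd
  have hAeq : A = matrix3132 p (p * a) (p * b) (p * c) (p * d) := by
    ext i j
    fin_cases i <;> fin_cases j <;> first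
      | exact htri _ _ (by decide)
      | exact hlast _
      | simpa [matrix3132]
  have h11 := hmul 1 1
  have h22 := hmul 2 2
  have h33 := hmul 3 3
  rw [hAeq, inColSpan_matrix3132_iff] at h11 h22 h33
  clear hmul hdiag hlast hdvd htri hbd
  subst hAeq
  generalize (p : ℤ) = q at *
  have hq0' : q ≠ 0 := hq0.ne'
  have hq2 : q ^ 2 ≠ 0 := by positivity
  simp [matrix3132, hq0'] at h11 h22 h33
  have hqa : q ∣ a * (a - 1) := by
    obtain ⟨x₀, h₀⟩ := h11
    exact ⟨x₀, mul_left_cancel₀ hq2 (by linear_combination -h₀)⟩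
  obtain ⟨x, rfl⟩ : q ∣ b := by
    obtain ⟨x₀, h₀⟩ := h22
    exact hp'.dvd_of_dvd_pow (n := 2)
      ⟨x₀ + q * b, mul_left_cancel₀ hq2 (by linear_combination -h₀)⟩
  obtain ⟨x₀, x₂, h₀, h₂⟩ := h33
  obtain ⟨z, rfl⟩ : q ∣ d := hp'.dvd_of_dvd_pow (n := 2)
    ⟨x₂ + d, mul_left_cancel₀ hq2 (by linear_combination -h₂)⟩
  obtain rfl : x₂ = q * (z ^ 2 - z) :=
    mul_left_cancel₀ (pow_ne_zero 3 hq0') (by linear_combination h₂)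
  obtain ⟨y, rfl⟩ : q ∣ c := hp'.dvd_of_dvd_pow (n := 2)
    ⟨x₀ + x * (z ^ 2 - z) + c, mul_left_cancel₀ hq2 (by linear_combination -h₀)⟩
  have bound : ∀ t : ℤ, 0 ≤ q * (q * t) ∧ q * (q * t) < q ^ 3 → 0 ≤ t ∧ t < q := fun t ht => by
    have hq2' : 0 < q ^ 2 := by positivity
    exact ⟨nonneg_of_mul_nonneg_right (by linarith [ht.1] : 0 ≤ q ^ 2 * t) hq2',
      lt_of_mul_lt_mul_left (by linarith [ht.2] : q ^ 2 * t < q ^ 2 * q) hq2'.le⟩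
  have ha0 : 0 ≤ a := nonneg_of_mul_nonneg_right bda.1 hq0
  have ha2 : a < q * q := lt_of_mul_lt_mul_left (by linarith [bda.2] : q * a < q * (q * q)) hq0.le
  obtain ⟨e, k, he, rfl⟩ : ∃ e k : ℤ, (e = 0 ∨ e = 1) ∧ a = e + q * k := by
    rcases hp'.dvd_or_dvd hqa with ⟨k, hk⟩ | ⟨k, hk⟩
    · exact ⟨0, k, .inl rfl, by linarith⟩
    · exact ⟨1, k, .inr rfl, by linarith⟩
  have hk : 0 ≤ k ∧ k < q := by
    have := hp'.ne_one
    constructor <;> by_contra! h <;>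
      nlinarith [show 2 ≤ q by omega, show e ≤ 1 by omega, show 0 ≤ e by omega]
  refine ⟨e, k, x, y, z, he, hk, bound x bdb, bound y bdc, bound z bdd, ?_⟩
  congr 1 <;> ring

theorem g_3132 (p : ℕ) (hp : p.Prime) :
    (gComp p ![3, 1, 3, 2] : ℤ) = 2 * (p : ℤ) ^ 4 := by
  have hp2 : (2 : ℤ) ≤ p := by exact_mod_cast hp.two_le
  let f : Fin 2 × Fin p × Fin p × Fin p × Fin p →
      {A : Matrix (Fin 5) (Fin 5) ℤ // IsIrreducibleSubringMatrix p ![3, 1, 3, 2] A} :=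
    fun t => ⟨matrix3132 p (p * ((t.1 : ℕ) + p * (t.2.1 : ℕ))) (p ^ 2 * (t.2.2.1 : ℕ))
      (p ^ 2 * (t.2.2.2.1 : ℕ)) (p ^ 2 * (t.2.2.2.2 : ℕ)),
      isIrreducibleSubringMatrix_matrix3132 hp (by omega) (by omega) (by omega) (by omega)
        (by omega)⟩
  have hf : Function.Bijective f := by
    constructor
    · rintro ⟨e, k, x, y, z⟩ ⟨e', k', x', y', z'⟩ h
      have h := congrArg Subtype.val h
      have ha := congrFun (congrFun h 0) 1
      have hb := congrFun (congrFun h 0) 2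
      have hc := congrFun (congrFun h 0) 3
      have hd := congrFun (congrFun h 2) 3
      simp [f, matrix3132, hp.ne_zero, Fin.val_inj] at ha hb hc hd
      have hee : e = e' := by
        have := congrArg (· % (p : ℤ)) ha
        simp only [Int.add_mul_emod_self_left] at this
        rw [Int.emod_eq_of_lt (by omega) (by omega), Int.emod_eq_of_lt (by omega) (by omega)]
          at this
        omega
      subst hee
      simp [hp.ne_zero, Fin.val_inj] at ha
      simp [ha, hb, hc, hd]
    · rintro ⟨A, hA⟩
      obtain ⟨e, k, x, y, z, he, hk, hx, hy, hz, rfl⟩ := exists_eq_matrix3132 hp hA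
      refine ⟨(⟨e.toNat, by omega⟩, ⟨k.toNat, by omega⟩, ⟨x.toNat, by omega⟩,
        ⟨y.toNat, by omega⟩, ⟨z.toNat, by omega⟩), Subtype.ext ?_⟩
      have he' : 0 ≤ e := by omega
      simp [f, he', hk.1, hx.1, hy.1, hz.1]
  rw [gComp, ← Nat.card_eq_of_bijective f hf]
  simp
  ring
end
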